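/- arXiv:2106.15521 — 2 statements merged into one kernel-verified Lean document; each statement's English description precedes it below -/
import Mathlib

section
/- Let n be an integer with 1 ≤ n ≤ 200 and let α satisfy 0.0001 < α < 0.27. Let (l_x, u_x), x = 0,…,n, be the OLC equal-tail intervals at level 1−2α (so u is the OLC upper endpoint sequence and l is the OLC lower endpoint sequence, each at level 1−α). Let (l'_x, u'_x), x = 0,…,n, be any equal-tail LCC estimator at level 1−2α (so 0 < u'_0 < ⋯ < u'_n = 1 gives upper-tail LCC intervals at level 1−α and 0 = l'_0 < l'_1 < ⋯ < l'_n < 1 gives lower-tail LCC intervals at level 1−α). Then ∫_0^1 Σ_{x=0}^n (u_x − l_x) B(n,x,p) dp ≤ ∫_0^1 Σ_{x=0}^n (u'_x − l'_x) B(n,x,p) dp; that is, the OLC method has the smallest average expected length of any LCC equal-tail estimator. -/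
open MeasureTheory

/-- The binomial probability mass function: `B n x p = C(n,x) p^x (1-p)^(n-x)`. -/
noncomputable def B (n x : ℕ) (p : ℝ) : ℝ :=
  (n.choose x : ℝ) * p ^ x * (1 - p) ^ (n - x)

/-- A sequence `0 < u 0 < u 1 < ⋯ < u n = 1` of OLC upper endpoints at level `1 - α`:
each inter-spike average coverage equals the nominal level. -/
def IsOLCUpper (n : ℕ) (α : ℝ) (u : ℕ → ℝ) : Prop :=
  0 < u 0 ∧ (∀ i, i < n → u i < u (i + 1)) ∧ u n = 1 ∧
    ∀ i, 1 ≤ i → i ≤ n →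
      (∫ p in (u (i - 1))..(u i), ∑ x ∈ Finset.Icc i n, B n x p)
        = (1 - α) * (u i - u (i - 1))

/-- A sequence `0 < v 0 < v 1 < ⋯ < v n = 1` giving upper-tail locally correct confidence
(LCC) intervals at level `1 - α`: each inter-spike average coverage is at least the
nominal level. -/
def IsLCCUpper (n : ℕ) (α : ℝ) (v : ℕ → ℝ) : Prop :=
  0 < v 0 ∧ (∀ i, i < n → v i < v (i + 1)) ∧ v n = 1 ∧
    ∀ i, 1 ≤ i → i ≤ n →
      (1 - α) * (v i - v (i - 1))
        ≤ ∫ p in (v (i - 1))..(v i), ∑ x ∈ Finset.Icc i n, B n x p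

/-- A sequence `0 = l 0 < l 1 < ⋯ < l n < 1` of OLC lower endpoints at level `1 - α`. -/
def IsOLCLower (n : ℕ) (α : ℝ) (l : ℕ → ℝ) : Prop :=
  l 0 = 0 ∧ (∀ i, i < n → l i < l (i + 1)) ∧ l n < 1 ∧
    ∀ i, i < n →
      (∫ p in (l i)..(l (i + 1)), ∑ x ∈ Finset.range (i + 1), B n x p)
        = (1 - α) * (l (i + 1) - l i)

/-- A sequence `0 = l 0 < l 1 < ⋯ < l n < 1` giving lower-tail LCC intervals at level
`1 - α`. -/
def IsLCCLower (n : ℕ) (α : ℝ) (l : ℕ → ℝ) : Prop :=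
  l 0 = 0 ∧ (∀ i, i < n → l i < l (i + 1)) ∧ l n < 1 ∧
    ∀ i, i < n →
      (1 - α) * (l (i + 1) - l i)
        ≤ ∫ p in (l i)..(l (i + 1)), ∑ x ∈ Finset.range (i + 1), B n x p

/-- The unnormalised beta density `x ^ K * (1 - x) ^ J`. -/
noncomputable def betaKernel (K J : ℕ) (x : ℝ) : ℝ := x ^ K * (1 - x) ^ J

lemma betaKernel_one_sub (K J : ℕ) (x : ℝ) : betaKernel K J (1 - x) = betaKernel J K x := by
  simp [betaKernel, mul_comm]

/-- If the derivative of `f` stays nonnegative once it has been positive, then `f` does not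
decrease any more after it has increased. -/
lemma le_of_deriv_sign_persists {f f' : ℝ → ℝ} {S : ℝ} (hc : ContinuousOn f (Set.Icc 0 S))
    (hd : ∀ x ∈ Set.Ioo 0 S, HasDerivAt f (f' x) x)
    (hs : ∀ x y, 0 < x → x < y → y < S → 0 < f' x → 0 ≤ f' y)
    {x s t : ℝ} (hx : 0 ≤ x) (hxs : x < s) (hst : s ≤ t) (ht : t ≤ S) (h : f x < f s) :
    f s ≤ f t := by
  obtain ⟨ξ, hξ, hξ'⟩ := exists_hasDerivAt_eq_slope f f' hxs
    (hc.mono (Set.Icc_subset_Icc hx (hst.trans ht)))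
    (fun y hy => hd y ⟨hx.trans_lt hy.1, hy.2.trans_le (hst.trans ht)⟩)
  have hpos : 0 < f' ξ := by
    rw [hξ']; exact div_pos (by linarith) (by linarith)
  have hξ0 : 0 < ξ := hx.trans_lt hξ.1
  have hmono : MonotoneOn f (Set.Icc ξ S) := by
    apply monotoneOn_of_deriv_nonneg (convex_Icc _ _)
      (hc.mono (Set.Icc_subset_Icc hξ0.le le_rfl))
    · intro y hy
      rw [interior_Icc] at hy
      exact (hd y ⟨hξ0.trans hy.1, hy.2⟩).differentiableAt.differentiableWithinAt
    · intro y hy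
      rw [interior_Icc] at hy
      rw [(hd y ⟨hξ0.trans hy.1, hy.2⟩).deriv]
      exact hs ξ y hξ0 hy.1 hy.2 hpos
  exact hmono ⟨hξ.2.le, hst.trans ht⟩ ⟨(hξ.2.trans_le hst).le, ht⟩ hst

/-- Logarithm of the ratio of the beta kernel at `c + y` and `c - y`. -/
noncomputable def logRatio (K J : ℕ) (c y : ℝ) : ℝ :=
  K * (Real.log (c + y) - Real.log (c - y)) +
    J * (Real.log (1 - c - y) - Real.log (1 - c + y))

/-- Numerator of the derivative of `logRatio`. -/
def logRatioNum (K J : ℕ) (c y : ℝ) : ℝ :=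
  K * c * ((1 - c) ^ 2 - y ^ 2) - J * (1 - c) * (c ^ 2 - y ^ 2)

lemma hasDerivAt_logRatio (K J : ℕ) {c y : ℝ} (hc : c ≤ 1 / 2) (hy : 0 ≤ y) (hyc : y < c) :
    HasDerivAt (logRatio K J c)
      (logRatioNum K J c y * (2 / ((c ^ 2 - y ^ 2) * ((1 - c) ^ 2 - y ^ 2)))) y := by
  have h1 : c + y ≠ 0 := by linarith
  have h2 : c - y ≠ 0 := by linarith
  have h3 : 1 - c - y ≠ 0 := by linarith
  have h4 : 1 - c + y ≠ 0 := by linarith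
  have d1 : HasDerivAt (fun y => c + y) 1 y := by simpa using (hasDerivAt_id y).const_add c
  have d2 : HasDerivAt (fun y => c - y) (-1) y := by simpa using (hasDerivAt_id y).const_sub c
  have d3 : HasDerivAt (fun y => 1 - c - y) (-1) y := by
    simpa using (hasDerivAt_id y).const_sub (1 - c)
  have d4 : HasDerivAt (fun y => 1 - c + y) 1 y := by
    simpa using (hasDerivAt_id y).const_add (1 - c)
  refine HasDerivAt.congr_deriv ((((d1.log h1).sub (d2.log h2)).const_mul (K : ℝ)).add
    (((d3.log h3).sub (d4.log h4)).const_mul (J : ℝ))) ?_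
  have e1 : c ^ 2 - y ^ 2 = (c + y) * (c - y) := by ring
  have e2 : (1 - c) ^ 2 - y ^ 2 = (1 - c - y) * (1 - c + y) := by ring
  rw [logRatioNum, e1, e2]
  field_simp
  ring

lemma logRatio_factor_pos {c y : ℝ} (hc : c ≤ 1 / 2) (hy : 0 ≤ y) (hyc : y < c) :
    0 < 2 / ((c ^ 2 - y ^ 2) * ((1 - c) ^ 2 - y ^ 2)) := by
  have h1 : 0 < c ^ 2 - y ^ 2 := by nlinarith
  have h2 : 0 < (1 - c) ^ 2 - y ^ 2 := by nlinarith
  positivity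

lemma logRatio_zero (K J : ℕ) (c : ℝ) : logRatio K J c 0 = 0 := by simp [logRatio]

lemma logRatioNum_persists (K J : ℕ) {c x y : ℝ} (hc : c ≤ 1 / 2) (hx : 0 < x) (hxy : x < y)
    (hyc : y < c) (h : 0 < logRatioNum K J c x) : 0 ≤ logRatioNum K J c y := by
  have hend : 0 ≤ logRatioNum K J c c := by
    have : logRatioNum K J c c = K * c * (1 - 2 * c) := by rw [logRatioNum]; ring
    rw [this]
    have : (0 : ℝ) ≤ 1 - 2 * c := by linarith
    have : 0 < c := by linarith
    positivity
  have key : (c ^ 2 - x ^ 2) * logRatioNum K J c y =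
      (c ^ 2 - y ^ 2) * logRatioNum K J c x + (y ^ 2 - x ^ 2) * logRatioNum K J c c := by
    simp only [logRatioNum]; ring
  have h1 : 0 < c ^ 2 - x ^ 2 := by nlinarith
  have h2 : 0 < c ^ 2 - y ^ 2 := by nlinarith
  have h3 : 0 < y ^ 2 - x ^ 2 := by nlinarith
  by_contra! hneg
  nlinarith [mul_pos h2 h, mul_nonneg h3.le hend, mul_pos_of_neg_of_neg hneg (neg_lt_zero.2 h1)]

lemma logRatio_eq (K J : ℕ) {c y : ℝ} (hc : c ≤ 1 / 2) (hy : 0 ≤ y) (hyc : y < c) :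
    logRatio K J c y =
      Real.log (betaKernel K J (c + y)) - Real.log (betaKernel K J (c - y)) := by
  have h1 : 0 < c + y := by linarith
  have h2 : 0 < c - y := by linarith
  have h3 : 0 < 1 - (c + y) := by linarith
  have h4 : 0 < 1 - (c - y) := by linarith
  rw [betaKernel, betaKernel, Real.log_mul (by positivity) (by positivity),
    Real.log_mul (by positivity) (by positivity), Real.log_pow, Real.log_pow, Real.log_pow,
    Real.log_pow, logRatio]
  rw [show 1 - (c + y) = 1 - c - y by ring, show 1 - (c - y) = 1 - c + y by ring]
  ring

lemma betaKernel_pos (K J : ℕ) {x : ℝ} (h0 : 0 < x) (h1 : x < 1) : 0 < betaKernel K J x := by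
  have : 0 < 1 - x := by linarith
  rw [betaKernel]; positivity

lemma continuousOn_logRatio (K J : ℕ) {c t : ℝ} (hc : c ≤ 1 / 2) (ht : t < c) :
    ContinuousOn (logRatio K J c) (Set.Icc 0 t) := fun _ hy =>
  (hasDerivAt_logRatio K J hc hy.1 (hy.2.trans_lt ht)).continuousAt.continuousWithinAt

lemma logRatio_persists (K J : ℕ) {c x y : ℝ} (hc : c ≤ 1 / 2) (hx : 0 < x) (hxy : x < y)
    (hyc : y < c) (h : 0 < logRatio K J c x) : 0 ≤ logRatio K J c y := by
  refine h.le.trans (le_of_deriv_sign_persists (continuousOn_logRatio K J hc hyc)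
    (fun z hz => hasDerivAt_logRatio K J hc hz.1.le (hz.2.trans hyc)) ?_ le_rfl hx hxy.le le_rfl
    (by rwa [logRatio_zero]))
  intro z w hz hzw hw hpos
  have hz' := logRatio_factor_pos hc hz.le (hzw.trans (hw.trans hyc))
  have hw' := logRatio_factor_pos hc (hz.trans hzw).le (hw.trans hyc)
  exact mul_nonneg (logRatioNum_persists K J hc hz hzw (hw.trans hyc)
    (pos_of_mul_pos_left hpos hz'.le)) hw'.le

lemma betaKernel_sub_persists_of_le_half (K J : ℕ) {c x y : ℝ} (hc : c ≤ 1 / 2) (hx : 0 < x)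
    (hxy : x < y) (hyc : y < c) (h : 0 < betaKernel K J (c + x) - betaKernel K J (c - x)) :
    0 ≤ betaKernel K J (c + y) - betaKernel K J (c - y) := by
  have hxc := hxy.trans hyc
  have h1 := logRatio_persists K J hc hx hxy hyc (by
    rw [logRatio_eq K J hc hx.le hxc, sub_pos]
    exact Real.log_lt_log (betaKernel_pos K J (by linarith) (by linarith)) (by linarith))
  rw [logRatio_eq K J hc (hx.trans hxy).le hyc, sub_nonneg] at h1
  rw [sub_nonneg]
  exact (Real.log_le_log_iff (betaKernel_pos K J (by linarith) (by linarith))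
    (betaKernel_pos K J (by linarith) (by linarith))).1 h1

lemma betaKernel_sub_persists_of_half_le (K J : ℕ) {c x y : ℝ} (hc : 1 / 2 ≤ c) (hx : 0 < x)
    (hxy : x < y) (hyc : y < 1 - c) (h : betaKernel K J (c + x) - betaKernel K J (c - x) < 0) :
    betaKernel K J (c + y) - betaKernel K J (c - y) ≤ 0 := by
  have e : ∀ z, betaKernel K J (c + z) - betaKernel K J (c - z) =
      -(betaKernel J K (1 - c + z) - betaKernel J K (1 - c - z)) := by
    intro z
    rw [← betaKernel_one_sub K J, ← betaKernel_one_sub K J,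
      show 1 - (1 - c + z) = c - z by ring, show 1 - (1 - c - z) = c + z by ring]
    ring
  rw [e] at h ⊢
  have := betaKernel_sub_persists_of_le_half J K (by linarith) hx hxy hyc (by linarith)
  linarith

lemma betaKernel_sub_nonneg (K J : ℕ) {c y : ℝ} (hc : c ≤ 1 / 2) (hm : (K + J) * c ≤ K)
    (hy : 0 ≤ y) (hyc : y < c) : 0 ≤ betaKernel K J (c + y) - betaKernel K J (c - y) := by
  have hmono : MonotoneOn (logRatio K J c) (Set.Icc 0 y) := by
    apply monotoneOn_of_deriv_nonneg (convex_Icc _ _) (continuousOn_logRatio K J hc hyc)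
    · intro z hz
      rw [interior_Icc] at hz
      exact (hasDerivAt_logRatio K J hc hz.1.le
        (hz.2.trans hyc)).differentiableAt.differentiableWithinAt
    · intro z hz
      rw [interior_Icc] at hz
      have hzc := hz.2.trans hyc
      rw [(hasDerivAt_logRatio K J hc hz.1.le hzc).deriv]
      refine mul_nonneg ?_ (logRatio_factor_pos hc hz.1.le hzc).le
      have hc0 : 0 < c := hy.trans_lt hyc
      have key : c ^ 2 * logRatioNum K J c z =
          (c ^ 2 - z ^ 2) * (c * (1 - c) * (K - (K + J) * c)) +
            z ^ 2 * (K * c * (1 - 2 * c)) := by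
        simp only [logRatioNum]; ring
      have h1 : 0 ≤ c ^ 2 - z ^ 2 := by nlinarith [hz.1]
      have h2 : 0 ≤ (K : ℝ) - (K + J) * c := by linarith
      have h3 : 0 ≤ 1 - c := by linarith
      have h4 : 0 ≤ 1 - 2 * c := by linarith
      have : 0 ≤ c ^ 2 * logRatioNum K J c z := by rw [key]; positivity
      exact nonneg_of_mul_nonneg_right this (by positivity)
  have h1 := hmono ⟨le_rfl, hy⟩ ⟨hy, le_rfl⟩ hy
  rw [logRatio_zero, logRatio_eq K J hc hy hyc, sub_nonneg] at h1
  rw [sub_nonneg]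
  exact (Real.log_le_log_iff (betaKernel_pos K J (by linarith) (by linarith))
    (betaKernel_pos K J (by linarith) (by linarith))).1 h1

lemma betaKernel_sub_nonpos (K J : ℕ) {c y : ℝ} (hc : 1 / 2 ≤ c) (hm : K ≤ (K + J) * c)
    (hy : 0 ≤ y) (hyc : y < 1 - c) : betaKernel K J (c + y) - betaKernel K J (c - y) ≤ 0 := by
  have := betaKernel_sub_nonneg J K (c := 1 - c) (y := y) (by linarith) (by linarith) hy hyc
  rw [← betaKernel_one_sub K J, ← betaKernel_one_sub K J,
      show 1 - (1 - c + y) = c - y by ring, show 1 - (1 - c - y) = c + y by ring] at this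
  linarith

/-- `F` is the distribution function of the beta distribution with parameters `K + 1`, `J + 1`. -/
structure IsBetaCDF (K J : ℕ) (F : ℝ → ℝ) : Prop where
  exists_hasDerivAt : ∃ C > 0, ∀ x, HasDerivAt F (C * betaKernel K J x) x
  zero : F 0 = 0
  one : F 1 = 1

namespace IsBetaCDF

variable {K J : ℕ} {F : ℝ → ℝ}

lemma continuous (hF : IsBetaCDF K J F) : Continuous F := by
  obtain ⟨C, -, h⟩ := hF.exists_hasDerivAt
  exact continuous_iff_continuousAt.2 fun x => (h x).continuousAt

lemma strictMonoOn (hF : IsBetaCDF K J F) : StrictMonoOn F (Set.Icc 0 1) := by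
  obtain ⟨C, hC, h⟩ := hF.exists_hasDerivAt
  refine strictMonoOn_of_deriv_pos (convex_Icc _ _) hF.continuous.continuousOn fun x hx => ?_
  rw [interior_Icc] at hx
  rw [(h x).deriv]
  exact mul_pos hC (betaKernel_pos K J hx.1 hx.2)

lemma symmSum_hasDerivAt {C : ℝ} (h : ∀ x, HasDerivAt F (C * betaKernel K J x) x) (c y : ℝ) :
    HasDerivAt (fun y => F (c + y) + F (c - y))
      (C * (betaKernel K J (c + y) - betaKernel K J (c - y))) y := by
  refine (((h (c + y)).comp_const_add c y).add ((h (c - y)).comp_const_sub c y)).congr_deriv ?_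
  ring

lemma symmSum_continuous (hF : IsBetaCDF K J F) (c : ℝ) :
    Continuous fun y => F (c + y) + F (c - y) := by
  have := hF.continuous
  fun_prop

lemma integral_symmSum (hF : IsBetaCDF K J F) (A c s : ℝ) :
    ∫ y in (0 : ℝ)..s, (F (c + y) + F (c - y) - 2 * A) =
      ∫ x in (c - s)..(c + s), (F x - A) := by
  have hc := hF.continuous
  have h1 : ∫ y in (0 : ℝ)..s, (F (c + y) - A) = ∫ x in c..(c + s), (F x - A) := by
    simpa using intervalIntegral.integral_comp_add_left (a := 0) (b := s) (fun x => F x - A) c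
  have h2 : ∫ y in (0 : ℝ)..s, (F (c - y) - A) = ∫ x in (c - s)..c, (F x - A) := by
    simpa using intervalIntegral.integral_comp_sub_left (a := 0) (b := s) (fun x => F x - A) c
  have hi : ∀ a b : ℝ, IntervalIntegrable (fun x => F x - A) volume a b :=
    fun a b => (by fun_prop : Continuous fun x => F x - A).intervalIntegrable a b
  rw [← intervalIntegral.integral_add_adjacent_intervals (hi (c - s) c) (hi c (c + s)), ← h1,
    ← h2, ← intervalIntegral.integral_add]
  · congr 1; ext y; ring
  · exact (by fun_prop : Continuous fun y => F (c - y) - A).intervalIntegrable _ _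
  · exact (by fun_prop : Continuous fun y => F (c + y) - A).intervalIntegrable _ _

lemma symmSum_persists_of_le_half (hF : IsBetaCDF K J F) {c x s t : ℝ} (hc : c ≤ 1 / 2)
    (hx : 0 ≤ x) (hxs : x < s) (hst : s ≤ t) (ht : t ≤ c)
    (h : F (c + x) + F (c - x) < F (c + s) + F (c - s)) :
    F (c + s) + F (c - s) ≤ F (c + t) + F (c - t) := by
  obtain ⟨C, hC, hd⟩ := hF.exists_hasDerivAt
  refine le_of_deriv_sign_persists (f := fun y => F (c + y) + F (c - y)) (S := c)
    (hF.symmSum_continuous c).continuousOn (fun y _ => symmSum_hasDerivAt hd c y) ?_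
    hx hxs hst ht h
  intro y z hy hyz hz hpos
  exact mul_nonneg hC.le (betaKernel_sub_persists_of_le_half K J hc hy hyz hz
    (pos_of_mul_pos_right hpos hC.le))

lemma symmSum_persists_of_half_le (hF : IsBetaCDF K J F) {c x s t : ℝ} (hc : 1 / 2 ≤ c)
    (hx : 0 ≤ x) (hxs : x < s) (hst : s ≤ t) (ht : t ≤ 1 - c)
    (h : F (c + s) + F (c - s) < F (c + x) + F (c - x)) :
    F (c + t) + F (c - t) ≤ F (c + s) + F (c - s) := by
  obtain ⟨C, hC, hd⟩ := hF.exists_hasDerivAt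
  refine neg_le_neg_iff.1 (le_of_deriv_sign_persists
    (f := fun y => -(F (c + y) + F (c - y))) (S := 1 - c)
    (hF.symmSum_continuous c).neg.continuousOn (fun y _ => (symmSum_hasDerivAt hd c y).neg) ?_
    hx hxs hst ht (neg_lt_neg h))
  intro y z hy hyz hz hpos
  have hneg : betaKernel K J (c + y) - betaKernel K J (c - y) < 0 := by
    by_contra! h0
    linarith [mul_nonneg hC.le h0]
  have := mul_nonneg hC.le (sub_nonneg.2 (betaKernel_sub_persists_of_half_le K J hc hy hyz hz hneg))
  linarith

lemma symmSum_antitoneOn (hF : IsBetaCDF K J F) {c : ℝ} (hc : 1 / 2 ≤ c)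
    (hm : K ≤ (K + J) * c) : AntitoneOn (fun y => F (c + y) + F (c - y)) (Set.Icc 0 (1 - c)) := by
  obtain ⟨C, hC, hd⟩ := hF.exists_hasDerivAt
  apply antitoneOn_of_deriv_nonpos (convex_Icc _ _) (hF.symmSum_continuous c).continuousOn
  · exact fun y _ => (symmSum_hasDerivAt hd c y).differentiableAt.differentiableWithinAt
  · intro y hy
    rw [interior_Icc] at hy
    rw [(symmSum_hasDerivAt hd c y).deriv]
    exact mul_nonpos_of_nonneg_of_nonpos hC.le (betaKernel_sub_nonpos K J hc hm hy.1.le hy.2)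

/-- Symmetric sums to the left of a mode `m ≥ 1 / 2` are at most `2 * F m`. -/
lemma symmSum_le_mode (hF : IsBetaCDF K J F) {c m s : ℝ} (hm : 1 / 2 ≤ m) (hm1 : m ≤ 1)
    (hmode : K ≤ (K + J) * m) (hcm : c ≤ m) (hs : 0 ≤ s) (hsc : s ≤ c) (hsc' : s ≤ 1 - c) :
    F (c + s) + F (c - s) ≤ 2 * F m := by
  have hmono := hF.strictMonoOn.monotoneOn
  have hanti := hF.symmSum_antitoneOn hm hmode
  have h0 : (0 : ℝ) ∈ Set.Icc 0 (1 - m) := ⟨le_rfl, by linarith⟩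
  rcases le_total s (1 - m) with h | h
  · have h1 := hanti h0 ⟨hs, h⟩ hs
    have h2 := hmono (a := c + s) (b := m + s) ⟨by linarith, by linarith⟩
      ⟨by linarith, by linarith⟩ (by linarith)
    have h3 := hmono (a := c - s) (b := m - s) ⟨by linarith, by linarith⟩
      ⟨by linarith, by linarith⟩ (by linarith)
    simp only [add_zero, sub_zero] at h1
    linarith
  · have h1 := hanti h0 ⟨by linarith, le_rfl⟩ (by linarith : (0 : ℝ) ≤ 1 - m)
    have h2 := hmono (a := c + s) (b := m + (1 - m)) ⟨by linarith, by linarith⟩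
      ⟨by linarith, by linarith⟩ (by linarith)
    have h3 := hmono (a := c - s) (b := m - (1 - m)) ⟨by linarith, by linarith⟩
      ⟨by linarith, by linarith⟩ (by linarith)
    simp only [add_zero, sub_zero] at h1
    linarith

/-- Enlarging symmetrically an interval on which the average of `F` is `A` keeps the mean of the
endpoint values at most `A`. -/
lemma symmSum_le (hF : IsBetaCDF K J F) {A c r s : ℝ} (hA : 1 / 2 ≤ A) (hr : 0 < r)
    (hint : ∫ x in (c - r)..(c + r), (F x - A) = 0)
    (hX : 1 / 2 < c → (K + J) * c < K → F (c + r) + F (c - r) < 2 * A ∨ A < F c)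
    (hrs : r ≤ s) (hsc : s ≤ c) (hsc' : s ≤ 1 - c) :
    F (c + s) + F (c - s) ≤ 2 * A := by
  have hcont := hF.symmSum_continuous c
  have hcont' : Continuous fun y => F (c + y) + F (c - y) - 2 * A := by fun_prop
  rw [← hF.integral_symmSum] at hint
  by_contra! hlt
  have hpos : ¬ ∀ y ∈ Set.Ioo 0 r, 0 < F (c + y) + F (c - y) - 2 * A := fun h => by
    have := intervalIntegral.intervalIntegral_pos_of_pos_on
      (hcont'.intervalIntegrable 0 r) h hr
    linarith
  have hneg : ¬ ∀ y ∈ Set.Ioo 0 r, F (c + y) + F (c - y) - 2 * A < 0 := fun h => by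
    have := intervalIntegral.intervalIntegral_pos_of_pos_on
      (hcont'.neg.intervalIntegrable 0 r) (fun y hy => neg_pos.2 (h y hy)) hr
    simp only [Pi.neg_apply, intervalIntegral.integral_neg] at this
    linarith
  rcases le_or_gt c (1 / 2) with hc | hc
  · have hend : F (c + c) + F (c - c) ≤ 1 := by
      have := hF.strictMonoOn.monotoneOn (a := c + c) (b := 1) ⟨by linarith, by linarith⟩
        ⟨by linarith, by linarith⟩ (by linarith)
      rw [sub_self, hF.zero]
      linarith [hF.one]
    refine hpos fun y hy => ?_
    by_contra! hy0
    have := hF.symmSum_persists_of_le_half hc hy.1.le (hy.2.trans_le hrs) hsc le_rfl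
      (by linarith)
    linarith
  rcases le_or_gt (K : ℝ) ((K + J) * c) with hm | hm
  · refine hpos fun y hy => ?_
    have := hF.symmSum_antitoneOn hc.le hm ⟨hy.1.le, by linarith [hy.2]⟩
      ⟨by linarith, hsc'⟩ (hy.2.le.trans hrs)
    simp only at this
    linarith
  rcases hX hc hm with h | h
  · have hrs' : r < s := lt_of_le_of_ne hrs (by rintro rfl; linarith)
    refine hneg fun y hy => ?_
    by_contra! hy0
    have := hF.symmSum_persists_of_half_le hc.le hy.1.le hy.2 hrs'.le hsc' (by linarith)
    linarith
  · refine hpos fun y hy => ?_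
    by_contra! hy0
    have := hF.symmSum_persists_of_half_le hc.le le_rfl hy.1 (hy.2.le.trans hrs) hsc'
      (by rw [add_zero, sub_zero]; linarith)
    linarith

lemma intervalIntegrable_sub (hF : IsBetaCDF K J F) (A a b : ℝ) :
    IntervalIntegrable (fun x => F x - A) volume a b := by
  have := hF.continuous
  exact (by fun_prop : Continuous fun x => F x - A).intervalIntegrable a b

lemma left_lt_of_integral_le (hF : IsBetaCDF K J F) {A a b : ℝ} (ha : 0 ≤ a) (hab : a < b)
    (hb : b ≤ 1) (hint : ∫ x in a..b, (F x - A) ≤ 0) : F a < A := by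
  by_contra! h
  refine hint.not_gt (intervalIntegral.intervalIntegral_pos_of_pos_on
    (hF.intervalIntegrable_sub A a b) (fun x hx => ?_) hab)
  have := hF.strictMonoOn ⟨ha, hab.le.trans hb⟩ ⟨ha.trans hx.1.le, hx.2.le.trans hb⟩ hx.1
  linarith

lemma lt_right_of_le_integral (hF : IsBetaCDF K J F) {A a b : ℝ} (ha : 0 ≤ a) (hab : a < b)
    (hb : b ≤ 1) (hint : 0 ≤ ∫ x in a..b, (F x - A)) : A < F b := by
  by_contra! h
  have := intervalIntegral.intervalIntegral_pos_of_pos_on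
    (hF.intervalIntegrable_sub A a b).neg (fun x hx => (?_ : 0 < -(F x - A))) hab
  · rw [Pi.neg_def, intervalIntegral.integral_neg] at this
    linarith
  · have := hF.strictMonoOn ⟨ha.trans hx.1.le, hx.2.le.trans hb⟩ ⟨ha.trans hab.le, hb⟩ hx.2
    linarith

lemma integral_neg_of_right_le (hF : IsBetaCDF K J F) {A a b : ℝ} (ha : 0 ≤ a) (hab : a < b)
    (hb : b ≤ 1) (h : F b ≤ A) : ∫ x in a..b, (F x - A) < 0 := by
  by_contra! h'
  linarith [hF.lt_right_of_le_integral ha hab hb h']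

lemma integral_pos_of_le_left (hF : IsBetaCDF K J F) {A a b : ℝ} (ha : 0 ≤ a) (hab : a < b)
    (hb : b ≤ 1) (h : A ≤ F a) : 0 < ∫ x in a..b, (F x - A) := by
  by_contra! h'
  linarith [hF.left_lt_of_integral_le ha hab hb h']

/-- If the right endpoint moves to the left, the left endpoint has to move to the right. -/
lemma left_le_of_right_le (hF : IsBetaCDF K J F) {A a b a' b' : ℝ} (ha : 0 ≤ a) (hab : a < b)
    (hb : b ≤ 1) (hint : ∫ x in a..b, (F x - A) = 0) (ha' : 0 ≤ a') (hab' : a' < b')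
    (hbb : b' ≤ b) (hint' : 0 ≤ ∫ x in a'..b', (F x - A)) : a ≤ a' := by
  by_contra! haa
  have hI := hF.intervalIntegrable_sub A
  have hFb := hF.lt_right_of_le_integral ha' hab' (hbb.trans hb) hint'
  have hFa := hF.left_lt_of_integral_le ha hab hb hint.le
  have h1 := hF.integral_neg_of_right_le ha' haa (hab.le.trans hb) hFa.le
  have h2 : 0 ≤ ∫ x in b'..b, (F x - A) := by
    rcases hbb.eq_or_lt with rfl | hlt
    · simp
    · exact (hF.integral_pos_of_le_left (by linarith) hlt hb hFb.le).le
  have h3 := intervalIntegral.integral_add_adjacent_intervals (hI a' b') (hI b' b)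
  have h4 := intervalIntegral.integral_add_adjacent_intervals (hI a' a) (hI a b)
  linarith

/-- If the right endpoint moves to the right, the left endpoint can move to the left by at most
the same amount. -/
lemma left_sub_le (hF : IsBetaCDF K J F) {A a b a' b' : ℝ} (hA : 1 / 2 ≤ A) (ha : 0 ≤ a)
    (hab : a < b) (hint : ∫ x in a..b, (F x - A) = 0)
    (hX : 1 / 2 < (a + b) / 2 → (K + J) * ((a + b) / 2) < K →
      F b + F a < 2 * A ∨ A < F ((a + b) / 2))
    (ha' : 0 ≤ a') (hbb : b ≤ b') (hb' : b' ≤ 1)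
    (hint' : 0 ≤ ∫ x in a'..b', (F x - A)) : a - a' ≤ b' - b := by
  by_contra! hlt
  have hI := hF.intervalIntegrable_sub A
  have hFa := hF.left_lt_of_integral_le ha hab (hbb.trans hb') hint.le
  have h1 : ∫ x in a'..(a - (b' - b)), (F x - A) < 0 :=
    hF.integral_neg_of_right_le ha' (by linarith) (by linarith)
      ((hF.strictMonoOn.monotoneOn ⟨by linarith, by linarith⟩ ⟨ha, by linarith⟩
        (by linarith)).trans hFa.le)
  set c := (a + b) / 2 with hc
  set r := (b - a) / 2 with hr
  have e1 : c - r = a := by rw [hc, hr]; ring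
  have e2 : c + r = b := by rw [hc, hr]; ring
  have h2 : ∫ x in (a - (b' - b))..b', (F x - A) ≤ 0 := by
    rw [← e1, ← e2] at hint
    have hle : ∀ y ∈ Set.Icc r (r + (b' - b)), F (c + y) + F (c - y) - 2 * A ≤ 0 := fun y hy => by
      have := hF.symmSum_le hA (by rw [hr]; linarith) hint (by rwa [e1, e2]) hy.1
        (by linarith [hy.2]) (by linarith [hy.2])
      linarith
    have e3 : a - (b' - b) = c - (r + (b' - b)) := by rw [hc, hr]; ring
    have e4 : b' = c + (r + (b' - b)) := by rw [hc, hr]; ring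
    rw [e3]
    nth_rewrite 2 [e4]
    rw [← hF.integral_symmSum]
    rw [← hF.integral_symmSum] at hint
    have hcont := hF.symmSum_continuous c
    have hI' : ∀ p q, IntervalIntegrable (fun y => F (c + y) + F (c - y) - 2 * A) volume p q :=
      fun p q => (by fun_prop : Continuous fun y =>
        F (c + y) + F (c - y) - 2 * A).intervalIntegrable p q
    rw [← intervalIntegral.integral_add_adjacent_intervals (hI' 0 r) (hI' r _), hint, zero_add]
    have := intervalIntegral.integral_nonneg (f := fun y => -(F (c + y) + F (c - y) - 2 * A))
      (μ := volume) (by linarith : r ≤ r + (b' - b)) (fun y hy => by linarith [hle y hy])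
    rw [intervalIntegral.integral_neg] at this
    linarith
  have h3 := intervalIntegral.integral_add_adjacent_intervals (hI a' (a - (b' - b)))
    (hI (a - (b' - b)) b')
  linarith

end IsBetaCDF

lemma integral_one_sub_sq_pow_succ (J : ℕ) :
    (2 * (J : ℝ) + 3) * ∫ v in (0 : ℝ)..1, (1 - v ^ 2) ^ (J + 1) =
      (2 * J + 2) * ∫ v in (0 : ℝ)..1, (1 - v ^ 2) ^ J := by
  have hd : ∀ v ∈ Set.uIcc (0 : ℝ) 1, HasDerivAt (fun v : ℝ => v * (1 - v ^ 2) ^ (J + 1))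
      ((2 * J + 3) * (1 - v ^ 2) ^ (J + 1) - (2 * J + 2) * (1 - v ^ 2) ^ J) v := by
    intro v _
    have h1 : HasDerivAt (fun v : ℝ => 1 - v ^ 2) (-(2 * v)) v := by
      simpa using (hasDerivAt_pow 2 v).const_sub 1
    refine ((hasDerivAt_id v).mul (h1.pow (J + 1))).congr_deriv ?_
    simp only [id, Nat.add_sub_cancel, Pi.pow_apply]
    push_cast
    ring
  have h := intervalIntegral.integral_eq_sub_of_hasDerivAt hd
    ((by fun_prop : Continuous _).intervalIntegrable 0 1)
  rw [intervalIntegral.integral_sub ((by fun_prop : Continuous _).intervalIntegrable 0 1)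
    ((by fun_prop : Continuous _).intervalIntegrable 0 1), intervalIntegral.integral_const_mul,
    intervalIntegral.integral_const_mul] at h
  norm_num at h
  linarith

lemma integral_one_sub_sq_sq : ∫ v in (0 : ℝ)..1, (1 - v ^ 2) ^ 2 = 8 / 15 := by
  have hd : ∀ v ∈ Set.uIcc (0 : ℝ) 1,
      HasDerivAt (fun v : ℝ => v - 2 / 3 * v ^ 3 + 1 / 5 * v ^ 5) ((1 - v ^ 2) ^ 2) v := by
    intro v _
    refine (((hasDerivAt_id v).sub ((hasDerivAt_pow 3 v).const_mul (2 / 3))).add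
      ((hasDerivAt_pow 5 v).const_mul (1 / 5))).congr_deriv ?_
    norm_num
    ring
  rw [intervalIntegral.integral_eq_sub_of_hasDerivAt hd
    ((by fun_prop : Continuous _).intervalIntegrable 0 1)]
  norm_num

lemma hasDerivAt_one_add_mul_exp_neg (v : ℝ) :
    HasDerivAt (fun v : ℝ => (1 + v) * Real.exp (-v)) (-v * Real.exp (-v)) v := by
  refine (((hasDerivAt_id v).const_add 1).mul ((hasDerivAt_neg v).exp)).congr_deriv ?_
  simp only [id]
  ring

lemma integral_one_add_mul_exp_neg_sq_le {T : ℝ} (hT : 0 ≤ T) :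
    ∫ v in (0 : ℝ)..T, ((1 + v) * Real.exp (-v)) ^ 2 ≤ 5 / 4 := by
  have hd : ∀ v ∈ Set.uIcc (0 : ℝ) T,
      HasDerivAt (fun v : ℝ => -((1 / 2 * v ^ 2 + 3 / 2 * v + 5 / 4) * Real.exp (-v) ^ 2))
        (((1 + v) * Real.exp (-v)) ^ 2) v := by
    intro v _
    refine ((((((hasDerivAt_pow 2 v).const_mul (1 / 2)).add
      ((hasDerivAt_id v).const_mul (3 / 2))).add_const (5 / 4)).mul
        ((hasDerivAt_neg v).exp.pow 2)).neg).congr_deriv ?_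
    simp only [id]
    norm_num
    ring
  rw [intervalIntegral.integral_eq_sub_of_hasDerivAt hd
    ((by fun_prop : Continuous _).intervalIntegrable 0 T)]
  have : 0 ≤ (1 / 2 * T ^ 2 + 3 / 2 * T + 5 / 4) * Real.exp (-T) ^ 2 := by positivity
  norm_num
  linarith

lemma integral_one_add_mul_exp_neg_pow_succ_le (J : ℕ) {T : ℝ} (hT : 0 ≤ T) :
    (2 * J + 3) * ∫ v in (0 : ℝ)..T, ((1 + v) * Real.exp (-v)) ^ (J + 1) ≤
      (2 * J + 2) * (∫ v in (0 : ℝ)..T, ((1 + v) * Real.exp (-v)) ^ J) +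
        T * ((1 + T) * Real.exp (-T)) ^ (J + 1) := by
  have hd : ∀ v ∈ Set.uIcc (0 : ℝ) T,
      HasDerivAt (fun v : ℝ => v * ((1 + v) * Real.exp (-v)) ^ (J + 1))
        (((1 + v) * Real.exp (-v)) ^ (J + 1) -
          (J + 1) * (v ^ 2 * Real.exp (-v)) * ((1 + v) * Real.exp (-v)) ^ J) v := by
    intro v _
    refine ((hasDerivAt_id v).mul ((hasDerivAt_one_add_mul_exp_neg v).pow (J + 1))).congr_deriv ?_
    simp only [id, Nat.add_sub_cancel, Pi.pow_apply]
    push_cast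
    ring
  have h := intervalIntegral.integral_eq_sub_of_hasDerivAt hd
    ((by fun_prop : Continuous _).intervalIntegrable 0 T)
  have hle := intervalIntegral.integral_mono_on (μ := volume) hT
    (f := fun v => (2 * J + 3) * ((1 + v) * Real.exp (-v)) ^ (J + 1) -
      (2 * J + 2) * ((1 + v) * Real.exp (-v)) ^ J)
    (g := fun v => ((1 + v) * Real.exp (-v)) ^ (J + 1) -
          (J + 1) * (v ^ 2 * Real.exp (-v)) * ((1 + v) * Real.exp (-v)) ^ J)
    ((by fun_prop : Continuous _).intervalIntegrable 0 T)
    ((by fun_prop : Continuous _).intervalIntegrable 0 T) (fun v hv => by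
      have hv0 := hv.1
      have h1 : (1 + v + v ^ 2 / 2) * Real.exp (-v) ≤ 1 := by
        have := Real.quadratic_le_exp_of_nonneg hv0
        calc (1 + v + v ^ 2 / 2) * Real.exp (-v) ≤ Real.exp v * Real.exp (-v) := by gcongr
          _ = 1 := by rw [← Real.exp_add]; simp
      have h2 : 0 ≤ 2 * (J + 1) * (1 - (1 + v + v ^ 2 / 2) * Real.exp (-v)) *
          ((1 + v) * Real.exp (-v)) ^ J := by
        have : 0 ≤ 1 - (1 + v + v ^ 2 / 2) * Real.exp (-v) := by linarith
        positivity
      have e : ((1 + v) * Real.exp (-v)) ^ (J + 1) =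
        ((1 + v) * Real.exp (-v)) * ((1 + v) * Real.exp (-v)) ^ J := pow_succ' _ _
      simp only [e]
      linarith)
  rw [h, intervalIntegral.integral_sub ((by fun_prop : Continuous _).intervalIntegrable 0 T)
    ((by fun_prop : Continuous _).intervalIntegrable 0 T), intervalIntegral.integral_const_mul,
    intervalIntegral.integral_const_mul] at hle
  norm_num at hle
  linarith

lemma tendsto_mul_one_add_mul_exp_neg_pow (J : ℕ) :
    Filter.Tendsto (fun T : ℝ => T * ((1 + T) * Real.exp (-T)) ^ (J + 1)) Filter.atTop
      (nhds 0) := by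
  have h : Filter.Tendsto (fun T : ℝ => T * ((1 + T) * Real.exp (-T))) Filter.atTop (nhds 0) := by
    have h1 := Real.tendsto_pow_mul_exp_neg_atTop_nhds_zero 1
    have h2 := Real.tendsto_pow_mul_exp_neg_atTop_nhds_zero 2
    have h3 := h1.add h2
    rw [add_zero] at h3
    refine h3.congr fun T => ?_
    ring
  refine squeeze_zero' ?_ ?_ h
  · filter_upwards [Filter.eventually_ge_atTop 0] with T hT
    positivity
  · filter_upwards [Filter.eventually_ge_atTop 0] with T hT
    have h0 : 0 ≤ (1 + T) * Real.exp (-T) := by positivity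
    have h1 : (1 + T) * Real.exp (-T) ≤ 1 := by
      calc (1 + T) * Real.exp (-T) ≤ Real.exp T * Real.exp (-T) := by
            gcongr; linarith [Real.add_one_le_exp T]
        _ = 1 := by rw [← Real.exp_add]; simp
    exact mul_le_mul_of_nonneg_left (pow_le_of_le_one h0 h1 (by simp)) hT

lemma integral_one_add_mul_exp_neg_pow_le {J : ℕ} (hJ : 2 ≤ J) : ∀ {T : ℝ}, 0 ≤ T →
    ∫ v in (0 : ℝ)..T, ((1 + v) * Real.exp (-v)) ^ J ≤
      75 / 32 * ∫ v in (0 : ℝ)..1, (1 - v ^ 2) ^ J := by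
  induction J, hJ using Nat.le_induction with
  | base =>
    intro T hT
    rw [integral_one_sub_sq_sq]
    linarith [integral_one_add_mul_exp_neg_sq_le hT]
  | succ J hJ ih =>
    intro T hT
    have hlim := (tendsto_mul_one_add_mul_exp_neg_pow J).const_add
      ((2 * (J : ℝ) + 2) * (75 / 32 * ∫ v in (0 : ℝ)..1, (1 - v ^ 2) ^ J))
    rw [add_zero] at hlim
    have hev : (2 * (J : ℝ) + 3) * ∫ v in (0 : ℝ)..T, ((1 + v) * Real.exp (-v)) ^ (J + 1) ≤
        (2 * J + 2) * (75 / 32 * ∫ v in (0 : ℝ)..1, (1 - v ^ 2) ^ J) := by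
      refine ge_of_tendsto hlim ?_
      filter_upwards [Filter.eventually_ge_atTop T] with T' hT'
      have hT0 : 0 ≤ T' := hT.trans hT'
      have hmono : ∫ v in (0 : ℝ)..T, ((1 + v) * Real.exp (-v)) ^ (J + 1) ≤
          ∫ v in (0 : ℝ)..T', ((1 + v) * Real.exp (-v)) ^ (J + 1) := by
        rw [← intervalIntegral.integral_add_adjacent_intervals
          ((by fun_prop : Continuous _).intervalIntegrable 0 T)
          ((by fun_prop : Continuous _).intervalIntegrable T T')]
        have := intervalIntegral.integral_nonneg (μ := volume) hT'
          (f := fun v => ((1 + v) * Real.exp (-v)) ^ (J + 1)) (fun v hv => by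
            have : 0 ≤ v := hT.trans hv.1
            positivity)
        linarith
      calc _ ≤ (2 * J + 3) * ∫ v in (0 : ℝ)..T', ((1 + v) * Real.exp (-v)) ^ (J + 1) := by gcongr
        _ ≤ _ := integral_one_add_mul_exp_neg_pow_succ_le J hT0
        _ ≤ _ := by gcongr; exact ih hT0
    have hR := integral_one_sub_sq_pow_succ J
    refine le_of_mul_le_mul_left (hev.trans_eq ?_) (by positivity : (0 : ℝ) < 2 * J + 3)
    linear_combination (-(75 / 32 : ℝ)) * hR

lemma one_add_pow_le_one_add_mul_pow {K J : ℕ} (hJ : 0 < J) (hJK : J ≤ K) {ρ v : ℝ} (hv : 0 ≤ v)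
    (hρ0 : 0 ≤ ρ) (hρ : ρ * K = J) : (1 + v) ^ J ≤ (1 + ρ * v) ^ K := by
  have hJ' : (0 : ℝ) < J := by exact_mod_cast hJ
  have hρv : 0 ≤ ρ * v := mul_nonneg hρ0 hv
  have h := one_add_mul_self_le_rpow_one_add (s := ρ * v) (by linarith) (p := (K : ℝ) / J)
    ((one_le_div hJ').2 (by exact_mod_cast hJK))
  have e : (K : ℝ) / J * (ρ * v) = v := by
    field_simp
    linear_combination v * hρ
  rw [e] at h
  calc (1 + v) ^ J ≤ ((1 + ρ * v) ^ ((K : ℝ) / J)) ^ J := by gcongr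
    _ = (1 + ρ * v) ^ K := by
      rw [← Real.rpow_natCast, ← Real.rpow_mul (by linarith), div_mul_cancel₀ _ hJ'.ne',
        Real.rpow_natCast]

lemma IsBetaCDF.mode_le {K J : ℕ} {F : ℝ → ℝ} (hF : IsBetaCDF K J F) (hJ : 2 ≤ J) (hJK : J ≤ K) :
    F (K / (K + J)) ≤ 0.73 := by
  obtain ⟨C, hC, hd⟩ := hF.exists_hasDerivAt
  have hJ' : (0 : ℝ) < J := by exact_mod_cast (by omega : 0 < J)
  have hK' : (0 : ℝ) < K := by exact_mod_cast (by omega : 0 < K)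
  have hfc : Continuous (betaKernel K J) := by unfold betaKernel; fun_prop
  set m : ℝ := K / (K + J) with hm
  set ρ : ℝ := J / K with hρ
  have hρK : ρ * K = J := by rw [hρ]; field_simp
  have hρ0 : 0 ≤ ρ := by positivity
  have hm0 : 0 < m := by positivity
  have h1m : 1 - m = m * ρ := by rw [hm, hρ]; field_simp; ring
  have h1m0 : 0 < 1 - m := by rw [h1m]; positivity
  have hL : F m = C * ∫ x in (0 : ℝ)..m, betaKernel K J x := by
    have := intervalIntegral.integral_eq_sub_of_hasDerivAt (a := 0) (b := m) (fun x _ => hd x)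
      ((hfc.const_mul C).intervalIntegrable 0 m)
    rw [intervalIntegral.integral_const_mul, hF.zero] at this
    linarith
  have hR : 1 - F m = C * ∫ x in m..1, betaKernel K J x := by
    have := intervalIntegral.integral_eq_sub_of_hasDerivAt (a := m) (b := 1) (fun x _ => hd x)
      ((hfc.const_mul C).intervalIntegrable m 1)
    rw [intervalIntegral.integral_const_mul, hF.one] at this
    linarith
  have hL' : ∫ x in (0 : ℝ)..m, betaKernel K J x =
      (1 - m) * ∫ v in (0 : ℝ)..(K / J), betaKernel K J (m - (1 - m) * v) := by
    rw [intervalIntegral.mul_integral_comp_sub_mul]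
    congr 1
    · rw [hm]; field_simp; ring
    · simp
  have hR' : ∫ x in m..1, betaKernel K J x =
      (1 - m) * ∫ v in (0 : ℝ)..1, betaKernel K J (m + (1 - m) * v) := by
    rw [intervalIntegral.mul_integral_comp_add_mul]
    congr 1 <;> ring
  have hLle : ∫ v in (0 : ℝ)..(K / J), betaKernel K J (m - (1 - m) * v) ≤
      m ^ K * (1 - m) ^ J * ∫ v in (0 : ℝ)..(K / J), ((1 + v) * Real.exp (-v)) ^ J := by
    rw [← intervalIntegral.integral_const_mul]
    refine intervalIntegral.integral_mono_on (by positivity)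
      ((by fun_prop : Continuous _).intervalIntegrable _ _)
      ((by fun_prop : Continuous _).intervalIntegrable _ _) fun v hv => ?_
    have hv1 : ρ * v ≤ 1 := by
      calc ρ * v ≤ ρ * (K / J) := by gcongr; exact hv.2
        _ = 1 := by rw [hρ]; field_simp
    have hv0 := hv.1
    have e : betaKernel K J (m - (1 - m) * v) =
        m ^ K * (1 - m) ^ J * ((1 + v) ^ J * (1 - ρ * v) ^ K) := by
      rw [betaKernel, show m - (1 - m) * v = m * (1 - ρ * v) by rw [h1m]; ring,
        show 1 - m * (1 - ρ * v) = (1 - m) * (1 + v) by linear_combination (-v) * h1m,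
        mul_pow, mul_pow]
      ring
    rw [e, mul_pow]
    gcongr
    calc (1 - ρ * v) ^ K ≤ Real.exp (-(ρ * v)) ^ K :=
          pow_le_pow_left₀ (by linarith) (Real.one_sub_le_exp_neg _) _
      _ = Real.exp (-v) ^ J := by
        rw [← Real.exp_nat_mul, ← Real.exp_nat_mul]
        congr 1
        linear_combination (-v) * hρK
  have hRge : m ^ K * (1 - m) ^ J * ∫ v in (0 : ℝ)..1, (1 - v ^ 2) ^ J ≤
      ∫ v in (0 : ℝ)..1, betaKernel K J (m + (1 - m) * v) := by
    rw [← intervalIntegral.integral_const_mul]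
    refine intervalIntegral.integral_mono_on (by positivity)
      ((by fun_prop : Continuous _).intervalIntegrable _ _)
      ((by fun_prop : Continuous _).intervalIntegrable _ _) fun v hv => ?_
    have hv0 := hv.1
    have hv1 : 0 ≤ 1 - v := sub_nonneg.2 hv.2
    have e : betaKernel K J (m + (1 - m) * v) =
        m ^ K * (1 - m) ^ J * ((1 + ρ * v) ^ K * (1 - v) ^ J) := by
      rw [betaKernel, show m + (1 - m) * v = m * (1 + ρ * v) by rw [h1m]; ring,
        show 1 - m * (1 + ρ * v) = (1 - m) * (1 - v) by linear_combination v * h1m,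
        mul_pow, mul_pow]
      ring
    rw [e, show 1 - v ^ 2 = (1 + v) * (1 - v) by ring, mul_pow]
    gcongr
    exact one_add_pow_le_one_add_mul_pow (by omega) hJK hv0 hρ0 hρK
  have hcmp := integral_one_add_mul_exp_neg_pow_le hJ (T := K / J) (by positivity)
  have hP : 0 < m ^ K * (1 - m) ^ J := by positivity
  have h1 : ∫ x in (0 : ℝ)..m, betaKernel K J x ≤ 75 / 32 * ∫ x in m..1, betaKernel K J x := by
    rw [hL', hR']
    have := mul_le_mul_of_nonneg_left hcmp hP.le
    nlinarith
  have h2 := mul_le_mul_of_nonneg_left h1 hC.le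
  linarith

/-- Cleared-denominator form of the bounds locating the last two endpoints. -/
lemma endpoint_numerics : ∀ k < 135,
    100 * (1000 * (k + 66)) ^ (k + 68) <
      73 * (k + 67) * 666 * (1000 * (k + 66)) ^ (k + 67) +
        100 * (1000 * (k + 66)) * (1000 * k + 65334) ^ (k + 67) ∧
    (1000 * (k + 66)) * (k + 65) ^ (k + 65) * (1000 * k + 65348) ^ (k + 67) +
        2 * (k + 67) * 652 * (k + 64) ^ (k + 65) * (1000 * (k + 66)) ^ (k + 67) <
      (k + 65) ^ (k + 65) * (1000 * (k + 66)) ^ (k + 68) ∧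
    100 * (1000 * k + 65348) ^ (k + 66) * (k + 67) * (1000 * (k + 66)) +
        100 * (1000 * k + 64620) ^ (k + 67) * (k + 65) <
      100 * (1000 * k + 64620) ^ (k + 66) * (k + 67) * (1000 * (k + 66)) +
        100 * (1000 * k + 65348) ^ (k + 67) * (k + 65) +
        73 * 728 * (k + 67) * (1000 * (k + 66)) ^ (k + 66) := by
  decide +kernel

/-- The even and odd parts of `(1 + z) ^ K`, doubled, with their elementary bounds. -/
lemma one_add_pow_one_sub_pow_bounds (K : ℕ) {z : ℝ} (hz : 0 ≤ z) :
    let D := (1 + z) ^ K - (1 - z) ^ K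
    let S := (1 + z) ^ K + (1 - z) ^ K
    2 * K * z ≤ D ∧ K * (K - 1) * z ^ 2 ≤ S - 2 ∧ 0 ≤ S - 2 ∧ D ≤ K * z * S ∧
      2 * (S - 2) ≤ (K - 1) * z * D ∧ D ≤ 2 * K * z + (K - 2) / 3 * z * (S - 2) := by
  induction K with
  | zero => norm_num
  | succ K ih =>
    intro D' S'
    obtain ⟨h1, h2, h0, h3, h4, h5⟩ := ih
    set D := (1 + z) ^ K - (1 - z) ^ K
    set S := (1 + z) ^ K + (1 - z) ^ K
    have hD : D' = D + z * S := by simp only [D', D, S, pow_succ]; ring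
    have hS : S' = S + z * D := by simp only [S', D, S, pow_succ]; ring
    have hK : (0 : ℝ) ≤ K := K.cast_nonneg
    have hD0 : 0 ≤ D := le_trans (by positivity) h1
    have hzD : 0 ≤ z * D := mul_nonneg hz hD0
    clear_value D S D' S'
    subst hD hS
    push_cast
    refine ⟨?_, ?_, ?_, ?_, ?_, ?_⟩
    · nlinarith
    · nlinarith
    · nlinarith
    · nlinarith [mul_nonneg (mul_nonneg hK hz) hzD, mul_nonneg hz hzD]
    · nlinarith [mul_le_mul_of_nonneg_left h3 hz]
    · nlinarith [mul_le_mul_of_nonneg_left h4 hz]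

lemma betaKernel_one_sub_le (K : ℕ) {c y : ℝ} (hc : 0 < c) (hc1 : c ≤ 1) (hy : 0 ≤ y)
    (hκ : 0 ≤ c - (1 - c) * (K - 2) / 3) :
    betaKernel K 1 (c + y) - betaKernel K 1 (c - y) ≤
      c ^ K * (2 * (K - (K + 1) * c) / c * y -
        (c - (1 - c) * (K - 2) / 3) * (K * (K - 1)) / c ^ 3 * y ^ 3) := by
  obtain ⟨z, rfl⟩ : ∃ z, y = c * z := ⟨y / c, by field_simp⟩
  have hz : 0 ≤ z := nonneg_of_mul_nonneg_right hy hc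
  obtain ⟨-, h2, h0, -, -, h5⟩ := one_add_pow_one_sub_pow_bounds K hz
  have e : betaKernel K 1 (c + c * z) - betaKernel K 1 (c - c * z) =
      c ^ K * ((1 - c) * ((1 + z) ^ K - (1 - z) ^ K) -
        c * z * ((1 + z) ^ K + (1 - z) ^ K)) := by
    rw [betaKernel, betaKernel, show c + c * z = c * (1 + z) by ring,
      show c - c * z = c * (1 - z) by ring, mul_pow, mul_pow]
    ring
  have e' : 2 * (K - (K + 1) * c) / c * (c * z) -
      (c - (1 - c) * (K - 2) / 3) * (K * (K - 1)) / c ^ 3 * (c * z) ^ 3 =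
      2 * (K - (K + 1) * c) * z - (c - (1 - c) * (K - 2) / 3) * (K * (K - 1)) * z ^ 3 := by
    field_simp
  rw [e, e']
  refine mul_le_mul_of_nonneg_left ?_ (by positivity)
  have := mul_le_mul_of_nonneg_left h5 (sub_nonneg.2 hc1)
  have := mul_le_mul_of_nonneg_left h2 (mul_nonneg hκ hz)
  linarith

namespace IsBetaCDF

lemma integral_mul_symmSum {K J : ℕ} {F : ℝ → ℝ} {C : ℝ}
    (h : ∀ x, HasDerivAt F (C * betaKernel K J x) x) (A c s : ℝ) :
    ∫ y in (0 : ℝ)..s, y * (C * (betaKernel K J (c + y) - betaKernel K J (c - y))) =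
      s * (F (c + s) + F (c - s) - 2 * A) -
        ∫ y in (0 : ℝ)..s, (F (c + y) + F (c - y) - 2 * A) := by
  have hF : Continuous F := continuous_iff_continuousAt.2 fun x => (h x).continuousAt
  have hb : Continuous (betaKernel K J) := by unfold betaKernel; fun_prop
  have := intervalIntegral.integral_mul_deriv_eq_deriv_mul (a := 0) (b := s)
    (u := fun y : ℝ => y) (u' := fun _ => 1) (v := fun y => F (c + y) + F (c - y) - 2 * A)
    (v' := fun y => C * (betaKernel K J (c + y) - betaKernel K J (c - y)))
    (fun y _ => hasDerivAt_id y) (fun y _ => (symmSum_hasDerivAt h c y).sub_const _)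
    (by simp) ((by fun_prop : Continuous fun y =>
      C * (betaKernel K J (c + y) - betaKernel K J (c - y))).intervalIntegrable _ _)
  simpa using this

lemma symmSum_lt_of_one {K : ℕ} {F : ℝ → ℝ} (hF : IsBetaCDF K 1 F) {A c s : ℝ} (hc : 0 < c)
    (hc1 : c ≤ 1) (hs : 0 < s) (hint : ∫ x in (c - s)..(c + s), (F x - A) = 0)
    (hκ : 0 ≤ c - (1 - c) * (K - 2) / 3)
    (h : 10 * (K - (K + 1) * c) * c ^ 2 <
      3 * ((c - (1 - c) * (K - 2) / 3) * (K * (K - 1))) * s ^ 2) :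
    F (c + s) + F (c - s) < 2 * A := by
  obtain ⟨C, hC, hd⟩ := hF.exists_hasDerivAt
  have hb : Continuous (betaKernel K 1) := by unfold betaKernel; fun_prop
  have h1 := integral_mul_symmSum hd A c s
  rw [hF.integral_symmSum, hint, sub_zero] at h1
  set P := 2 * (K - (K + 1) * c) / c with hP
  set R := (c - (1 - c) * (K - 2) / 3) * (K * (K - 1)) / c ^ 3 with hR
  have h2 : ∫ y in (0 : ℝ)..s, y * (C * (betaKernel K 1 (c + y) - betaKernel K 1 (c - y))) ≤
      ∫ y in (0 : ℝ)..s, C * c ^ K * (P * y ^ 2 - R * y ^ 4) := by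
    refine intervalIntegral.integral_mono_on hs.le
      ((by fun_prop : Continuous fun y =>
        y * (C * (betaKernel K 1 (c + y) - betaKernel K 1 (c - y)))).intervalIntegrable _ _)
      ((by fun_prop : Continuous fun y : ℝ =>
        C * c ^ K * (P * y ^ 2 - R * y ^ 4)).intervalIntegrable _ _) fun y hy => ?_
    have := mul_le_mul_of_nonneg_left (betaKernel_one_sub_le K hc hc1 hy.1 hκ)
      (mul_nonneg hy.1 hC.le)
    linarith
  have h3 : ∫ y in (0 : ℝ)..s, C * c ^ K * (P * y ^ 2 - R * y ^ 4) =
      C * c ^ K * (s ^ 3 / 15) * (5 * P - 3 * R * s ^ 2) := by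
    rw [intervalIntegral.integral_const_mul, intervalIntegral.integral_sub
      ((by fun_prop : Continuous fun y : ℝ => P * y ^ 2).intervalIntegrable _ _)
      ((by fun_prop : Continuous fun y : ℝ => R * y ^ 4).intervalIntegrable _ _),
      intervalIntegral.integral_const_mul, intervalIntegral.integral_const_mul, integral_pow,
      integral_pow]
    norm_num
    ring
  have h4 : 5 * P - 3 * R * s ^ 2 < 0 := by
    have : 5 * P - 3 * R * s ^ 2 = (10 * (K - (K + 1) * c) * c ^ 2 -
      3 * ((c - (1 - c) * (K - 2) / 3) * (K * (K - 1))) * s ^ 2) / c ^ 3 := by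
      rw [hP, hR]; field_simp; ring
    rw [this]
    exact div_neg_of_neg_of_pos (by linarith) (by positivity)
  have h5 : C * c ^ K * (s ^ 3 / 15) * (5 * P - 3 * R * s ^ 2) < 0 :=
    mul_neg_of_pos_of_neg (by positivity) h4
  by_contra! h6
  have := mul_nonneg hs.le (sub_nonneg.2 h6)
  linarith

end IsBetaCDF

lemma lower_endpoint_numerics {k : ℕ} (hk : k < 135) {b : ℝ}
    (hb : b = 1 - 0.666 / (k + 66)) :
    1 - b ^ (k + 67) < 0.73 * (k + 67) * (1 - b) := by
  have h : (100 * (1000 * (k + 66)) ^ (k + 68) : ℝ) <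
      73 * (k + 67) * 666 * (1000 * (k + 66)) ^ (k + 67) +
        100 * (1000 * (k + 66)) * (1000 * k + 65334) ^ (k + 67) := by
    exact_mod_cast (endpoint_numerics k hk).1
  have hd : (0 : ℝ) < 1000 * (k + 66) := by positivity
  have e : (1000 * k + 65334 : ℝ) = b * (1000 * (k + 66)) := by
    rw [hb]; field_simp; ring
  have e' : (666 : ℝ) = (1 - b) * (1000 * (k + 66)) := by rw [hb]; field_simp; ring
  rw [e, e'] at h
  generalize (1000 * ((k : ℝ) + 66)) = d at *
  rw [mul_pow] at h
  refine lt_of_mul_lt_mul_right ?_ (by positivity : 0 ≤ 100 * d ^ (k + 68))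
  rw [pow_succ d (k + 67)] at *
  linarith

lemma upper_endpoint_numerics {k : ℕ} (hk : k < 135) {b : ℝ}
    (hb : b = 1 - 0.652 / (k + 66)) :
    (k + 67) * (2 * ((k + 64) / (k + 65) : ℝ) ^ (k + 65)) * (1 - b) < 1 - b ^ (k + 67) := by
  have h : ((1000 * (k + 66)) * (k + 65) ^ (k + 65) * (1000 * k + 65348) ^ (k + 67) +
        2 * (k + 67) * 652 * (k + 64) ^ (k + 65) * (1000 * (k + 66)) ^ (k + 67) : ℝ) <
      (k + 65) ^ (k + 65) * (1000 * (k + 66)) ^ (k + 68) := by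
    exact_mod_cast (endpoint_numerics k hk).2.1
  have hd : (0 : ℝ) < 1000 * (k + 66) := by positivity
  have e : (1000 * k + 65348 : ℝ) = b * (1000 * (k + 66)) := by
    rw [hb]; field_simp; ring
  have e' : (652 : ℝ) = (1 - b) * (1000 * (k + 66)) := by rw [hb]; field_simp; ring
  rw [e, e'] at h
  generalize (1000 * ((k : ℝ) + 66)) = d at *
  rw [mul_pow] at h
  have hm : (0 : ℝ) < (k + 65) ^ (k + 65) := by positivity
  rw [div_pow]
  generalize ((k : ℝ) + 65) ^ (k + 65) = m at *
  refine lt_of_mul_lt_mul_right ?_ (by positivity : 0 ≤ m * d ^ (k + 68))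
  rw [pow_succ d (k + 67)] at *
  have : (k + 67) * (2 * ((k + 64 : ℝ) ^ (k + 65) / m)) * (1 - b) * (m * (d ^ (k + 67) * d)) =
      (k + 67) * (2 * ((k + 64 : ℝ) ^ (k + 65))) * (1 - b) * (d ^ (k + 67) * d) := by
    field_simp
  rw [this]
  linarith

lemma second_endpoint_numerics {k : ℕ} (hk : k < 135) {a b : ℝ}
    (ha : a = 1 - 1.38 / (k + 66)) (hb : b = 1 - 0.652 / (k + 66)) :
    (b ^ (k + 66) - (k + 65) / (k + 67) * b ^ (k + 67)) -
      (a ^ (k + 66) - (k + 65) / (k + 67) * a ^ (k + 67)) < 0.73 * (b - a) := by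
  have h : (100 * (1000 * k + 65348) ^ (k + 66) * (k + 67) * (1000 * (k + 66)) +
        100 * (1000 * k + 64620) ^ (k + 67) * (k + 65) : ℝ) <
      100 * (1000 * k + 64620) ^ (k + 66) * (k + 67) * (1000 * (k + 66)) +
        100 * (1000 * k + 65348) ^ (k + 67) * (k + 65) +
        73 * 728 * (k + 67) * (1000 * (k + 66)) ^ (k + 66) := by
    exact_mod_cast (endpoint_numerics k hk).2.2
  have hd : (0 : ℝ) < 1000 * (k + 66) := by positivity
  have e : (1000 * k + 65348 : ℝ) = b * (1000 * (k + 66)) := by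
    rw [hb]; field_simp; ring
  have e' : (1000 * k + 64620 : ℝ) = a * (1000 * (k + 66)) := by
    rw [ha]; field_simp; ring
  have e'' : (728 : ℝ) = (b - a) * (1000 * (k + 66)) := by rw [ha, hb]; field_simp; ring
  rw [e, e', e''] at h
  generalize (1000 * ((k : ℝ) + 66)) = d at *
  simp only [mul_pow] at h
  have hk' : (0 : ℝ) < k + 67 := by positivity
  refine lt_of_mul_lt_mul_right ?_ (by positivity : 0 ≤ 100 * (k + 67) * d ^ (k + 67))
  rw [pow_succ d (k + 66)] at *
  have : (b ^ (k + 66) - (k + 65) / (k + 67) * b ^ (k + 67) -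
      (a ^ (k + 66) - (k + 65) / (k + 67) * a ^ (k + 67))) *
        (100 * (k + 67) * (d ^ (k + 66) * d)) =
      ((k + 67) * b ^ (k + 66) - (k + 65) * b ^ (k + 67) -
      ((k + 67) * a ^ (k + 66) - (k + 65) * a ^ (k + 67))) * (100 * (d ^ (k + 66) * d)) := by
    field_simp
  rw [this]
  linarith

lemma one_sub_pow_mul_le (n : ℕ) {x y : ℝ} (hx : 0 ≤ x) (hxy : x ≤ y) (hy : y ≤ 1) :
    (1 - x ^ n) * (1 - y) ≤ (1 - y ^ n) * (1 - x) := by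
  rw [← geom_sum_mul_neg x n, ← geom_sum_mul_neg y n, mul_right_comm]
  have h : ∑ i ∈ Finset.range n, x ^ i ≤ ∑ i ∈ Finset.range n, y ^ i := by gcongr
  exact mul_le_mul_of_nonneg_right (mul_le_mul_of_nonneg_right h (by linarith)) (by linarith)

lemma top_endpoint_bounds {k : ℕ} (hk : k < 135) {A b : ℝ} (hA : 0.73 < A)
    (hA' : A ≤ 2 * ((k + 64) / (k + 65) : ℝ) ^ (k + 65)) (hb0 : 0 ≤ b) (hb1 : b < 1)
    (heq : A * (k + 67) * (1 - b) = 1 - b ^ (k + 67)) :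
    1 - 0.666 / (k + 66) ≤ b ∧ b ≤ 1 - 0.652 / (k + 66) := by
  have hn : (66 : ℝ) ≤ k + 66 := by linarith [k.cast_nonneg (α := ℝ)]
  have hk0 : (0 : ℝ) < k + 67 := by linarith
  constructor <;> by_contra! hlt
  · have h := lower_endpoint_numerics hk rfl
    generalize hx : 1 - 0.666 / ((k : ℝ) + 66) = x at *
    have hx1 : x < 1 := by
      rw [← hx, sub_lt_self_iff]; positivity
    have h' := one_sub_pow_mul_le (k + 67) hb0 hlt.le hx1.le
    rw [← heq] at h'
    have h2 := mul_lt_mul_of_pos_right h (sub_pos.2 hb1)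
    have h3 := mul_lt_mul_of_pos_right hA (mul_pos (mul_pos hk0 (sub_pos.2 hb1)) (sub_pos.2 hx1))
    linarith
  · have h := upper_endpoint_numerics hk rfl
    have hx0 : 0 ≤ 1 - 0.652 / ((k : ℝ) + 66) := by
      rw [sub_nonneg, div_le_one (by linarith)]; linarith
    generalize hx : 1 - 0.652 / ((k : ℝ) + 66) = x at *
    have h' := one_sub_pow_mul_le (k + 67) hx0 hlt.le hb1.le
    rw [← heq] at h'
    have h2 := mul_lt_mul_of_pos_right h (sub_pos.2 hb1)
    have h3 := mul_le_mul_of_nonneg_right hA'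
      (mul_pos (mul_pos hk0 (sub_pos.2 hb1)) (sub_pos.2 (hlt.trans hb1))).le
    linarith

namespace IsBetaCDF

lemma second_endpoint_bound {k : ℕ} (hk : k < 135) {F : ℝ → ℝ} (hF : IsBetaCDF (k + 64) 1 F)
    (hF' : ∀ p, F p = (k + 66) * p ^ (k + 65) - (k + 65) * p ^ (k + 66)) {A a b : ℝ}
    (hA : 0.73 < A) (ha : 0 ≤ a) (hab : a < b) (hb : b ≤ 1 - 0.652 / (k + 66))
    (hint : ∫ x in a..b, (F x - A) = 0) : 1 - 1.38 / (k + 66) ≤ a := by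
  by_contra! hlt
  have hn : (66 : ℝ) ≤ k + 66 := by linarith [k.cast_nonneg (α := ℝ)]
  have hnum := second_endpoint_numerics hk rfl rfl
  have hxy : 1 - 1.38 / (k + 66 : ℝ) < 1 - 0.652 / (k + 66) := by
    gcongr; norm_num
  have hy1 : 1 - 0.652 / (k + 66 : ℝ) ≤ 1 := by
    rw [sub_le_self_iff]; positivity
  generalize 1 - 1.38 / ((k : ℝ) + 66) = x at *
  generalize 1 - 0.652 / ((k : ℝ) + 66) = y at *
  have hI := hF.intervalIntegrable_sub 0.73
  have hd : ∀ p : ℝ, HasDerivAt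
      (fun p : ℝ => p ^ (k + 66) - (k + 65) / (k + 67) * p ^ (k + 67) - 0.73 * p)
      (F p - 0.73) p := by
    intro p
    refine (((hasDerivAt_pow _ p).sub ((hasDerivAt_pow _ p).const_mul _)).sub
      ((hasDerivAt_id p).const_mul _)).congr_deriv ?_
    rw [hF', show k + 66 - 1 = k + 65 by omega, show k + 67 - 1 = k + 66 by omega]
    push_cast
    field_simp
  have hxy0 : ∫ p in x..y, (F p - 0.73) < 0 := by
    rw [intervalIntegral.integral_eq_sub_of_hasDerivAt (fun p _ => hd p) (hI x y)]
    linarith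
  have hFb := hF.lt_right_of_le_integral ha hab (hb.trans hy1) hint.ge
  have hb0 : 0 ≤ b := ha.trans hab.le
  have hpos : ∀ z, b < z → z ≤ 1 → 0 < ∫ p in b..z, (F p - 0.73) := fun z hz hz1 =>
    hF.integral_pos_of_le_left hb0 hz hz1 (hA.trans hFb).le
  have hab0 : 0 ≤ ∫ p in a..b, (F p - 0.73) := by
    rw [← hint]
    exact intervalIntegral.integral_mono hab.le (hF.intervalIntegrable_sub A a b) (hI a b)
      fun p => by linarith
  have hay : 0 ≤ ∫ p in a..y, (F p - 0.73) := by
    rw [← intervalIntegral.integral_add_adjacent_intervals (hI a b) (hI b y)]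
    rcases hb.eq_or_lt with rfl | h
    · simpa using hab0
    · linarith [hpos y h hy1]
  have hFx := hF.left_lt_of_integral_le (ha.trans hlt.le) hxy hy1 hxy0.le
  have hax := hF.integral_neg_of_right_le ha hlt (hxy.le.trans hy1) hFx.le
  have := intervalIntegral.integral_add_adjacent_intervals (hI a x) (hI x y)
  linarith

lemma add_lt_of_one {k : ℕ} (hk : k < 135) {F : ℝ → ℝ} (hF : IsBetaCDF (k + 64) 1 F)
    (hF' : ∀ p, F p = (k + 66) * p ^ (k + 65) - (k + 65) * p ^ (k + 66)) {A a b : ℝ}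
    (hA : 0.73 < A) (hA' : A ≤ F ((k + 64) / (k + 65))) (ha : 0 ≤ a) (hab : a < b) (hb : b < 1)
    (heq : A * (k + 67) * (1 - b) = 1 - b ^ (k + 67))
    (hint : ∫ x in a..b, (F x - A) = 0) (hc : (k + 65) * ((a + b) / 2) < (k + 64 : ℝ)) :
    F b + F a < 2 * A := by
  have hn : (66 : ℝ) ≤ k + 66 := by linarith [k.cast_nonneg (α := ℝ)]
  have hm : F ((k + 64) / (k + 65)) = 2 * ((k + 64) / (k + 65) : ℝ) ^ (k + 65) := by
    rw [hF', pow_succ _ (k + 65)]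
    field_simp
    ring
  obtain ⟨hb1, hb2⟩ := top_endpoint_bounds hk hA (hm ▸ hA') (ha.trans hab.le) hb heq
  have ha1 := hF.second_endpoint_bound hk hF' hA ha hab hb2 hint
  obtain ⟨c, s, rfl, rfl⟩ : ∃ c s : ℝ, a = c - s ∧ b = c + s :=
    ⟨(a + b) / 2, (b - a) / 2, by ring, by ring⟩
  have hn' : ((k : ℝ) + 66) ≤ 200 := by
    have : (k : ℝ) + 1 ≤ 135 := by exact_mod_cast hk
    linarith
  have hc0 : c < 1 := by
    by_contra! h
    nlinarith
  set w : ℝ := 1 / (k + 66) with hw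
  have hwn : (k + 66) * w = 1 := by rw [hw]; field_simp
  have hw1 : 1 / 200 ≤ w := one_div_le_one_div_of_le (by linarith) hn'
  have hw2 : w ≤ 1 / 66 := one_div_le_one_div_of_le (by norm_num) hn
  rw [div_eq_mul_one_div, ← hw] at hb1 hb2 ha1
  clear_value w
  have hc1 : 1 - 1.023 * w ≤ c := by linarith
  have hE : (k + 64) - (k + 65) * c ≤ 0.0179 := by
    have := mul_le_mul_of_nonneg_left hc1 (by linarith : (0 : ℝ) ≤ k + 65)
    linarith
  have hκ : 0.659 ≤ c - (1 - c) * ((k + 64) - 2) / 3 := by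
    have := mul_le_mul_of_nonneg_left hc1 (by linarith : (0 : ℝ) ≤ k + 62)
    linarith
  have hs : 0.334 * w ≤ s := by
    have h1 : (k + 65) * (1 - 0.666 * w) ≤ (k + 65) * (c + s) := by gcongr
    have h2 : (k + 65) * (0.334 * w) ≤ (k + 65) * s := by linarith
    exact le_of_mul_le_mul_left h2 (by linarith)
  have hKs : 0.101 ≤ (k + 64) * ((k + 64) - 1) * s ^ 2 := by
    have h1 : 0.96 ≤ (k + 64) * w := by linarith
    have h2 : 0.95 ≤ (k + 63) * w := by linarith
    have h3 : 0.96 * 0.95 ≤ ((k + 64) * w) * ((k + 63) * w) :=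
      mul_le_mul h1 h2 (by norm_num) (by linarith)
    have h4 : (0.334 * w) ^ 2 ≤ s ^ 2 := by gcongr
    have h5 := mul_le_mul_of_nonneg_left h4
      (by positivity : (0 : ℝ) ≤ (k + 64) * (k + 63))
    linarith
  have h := hF.symmSum_lt_of_one (c := c) (s := s) (by linarith) hc0.le (by linarith) hint
  push_cast at h
  refine h (by linarith) ?_
  have h1 := mul_le_mul hκ hKs (by norm_num) (by linarith)
  have hc2 : c ^ 2 ≤ 1 := by nlinarith
  have h2 : 10 * (k + 64 - (k + 64 + 1) * c) * c ^ 2 ≤ 0.179 := by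
    have := mul_le_mul_of_nonneg_right hE (sq_nonneg c)
    linarith
  linarith

end IsBetaCDF

/-- Distribution of the upper tail of the binomial family. -/
noncomputable def upperTail (n i : ℕ) (p : ℝ) : ℝ := ∑ x ∈ Finset.Icc i n, B n x p

lemma upperTail_self (n : ℕ) (p : ℝ) : upperTail n n p = p ^ n := by
  simp [upperTail, B]

lemma upperTail_eq_add {n i : ℕ} (h : i ≤ n) (p : ℝ) :
    upperTail n i p = B n i p + upperTail n (i + 1) p := by
  rw [upperTail, upperTail, ← Finset.insert_Icc_add_one_left_eq_Icc h, Finset.sum_insert (by simp)]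

lemma hasDerivAt_B {n i : ℕ} (hi : i + 2 ≤ n) (p : ℝ) :
    HasDerivAt (B n (i + 1))
      (n * (n - 1).choose i * betaKernel i (n - (i + 1)) p -
        n * (n - 1).choose (i + 1) * betaKernel (i + 1) (n - (i + 2)) p) p := by
  obtain ⟨m, rfl⟩ := Nat.exists_eq_add_of_le hi
  have h1 : HasDerivAt (fun p : ℝ => 1 - p) (-1) p := (hasDerivAt_id p).const_sub 1
  refine (((hasDerivAt_pow (i + 1) p).const_mul (((i + 2 + m).choose (i + 1) : ℕ) : ℝ)).mul
    (h1.pow (i + 2 + m - (i + 1)))).congr_deriv ?_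
  have e1 : ((i + 2 + m).choose (i + 1) : ℝ) * (i + 1) = (i + 2 + m) * (i + 1 + m).choose i := by
    have := Nat.add_one_mul_choose_eq (i + 1 + m) i
    rw [show i + 1 + m + 1 = i + 2 + m by ring] at this
    exact_mod_cast this.symm
  have e2 : ((i + 2 + m).choose (i + 1) : ℝ) * (m + 1) =
      (i + 2 + m) * (i + 1 + m).choose (i + 1) := by
    have := Nat.choose_mul_succ_eq (i + 1 + m) (i + 1)
    rw [show i + 1 + m + 1 = i + 2 + m by ring, show i + 2 + m - (i + 1) = m + 1 by omega] at this
    rw [mul_comm (i + 2 + m : ℝ)]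
    exact_mod_cast this.symm
  simp only [betaKernel, show i + 2 + m - (i + 1) = m + 1 by omega,
    show i + 2 + m - (i + 2) = m by omega, show i + 2 + m - 1 = i + 1 + m by omega,
    Nat.add_sub_cancel, Pi.pow_apply]
  push_cast
  rw [← e1, ← e2]
  ring

lemma hasDerivAt_upperTail {n i : ℕ} (hi : i + 1 ≤ n) (p : ℝ) :
    HasDerivAt (upperTail n (i + 1))
      (n * (n - 1).choose i * betaKernel i (n - (i + 1)) p) p := by
  obtain ⟨m, hm⟩ := Nat.exists_eq_add_of_le hi
  induction m generalizing i with
  | zero =>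
    obtain rfl : n = i + 1 := hm
    rw [show upperTail (i + 1) (i + 1) = fun p => p ^ (i + 1) from
      funext (upperTail_self _)]
    simpa [betaKernel] using hasDerivAt_pow (i + 1) p
  | succ m ih =>
    rw [show upperTail n (i + 1) = B n (i + 1) + upperTail n (i + 1 + 1) from
      funext (upperTail_eq_add hi)]
    refine ((hasDerivAt_B (by omega) p).add (ih (by omega) (by omega))).congr_deriv ?_
    ring

lemma isBetaCDF_upperTail {n i : ℕ} (hi : i + 1 ≤ n) :
    IsBetaCDF i (n - (i + 1)) (upperTail n (i + 1)) where
  exists_hasDerivAt := by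
    refine ⟨n * (n - 1).choose i, ?_, hasDerivAt_upperTail hi⟩
    have := Nat.choose_pos (show i ≤ n - 1 by omega)
    have : 0 < n := by omega
    positivity
  zero := Finset.sum_eq_zero fun x hx => by
    have : x ≠ 0 := by have := (Finset.mem_Icc.1 hx).1; omega
    simp [B, this]
  one := by
    rw [upperTail, Finset.sum_eq_single n]
    · simp [B]
    · intro x hx hxn
      have : n - x ≠ 0 := by have := (Finset.mem_Icc.1 hx).2; omega
      simp [B, this]
    · simp [hi]

lemma upperTail_pred (m : ℕ) (p : ℝ) :
    upperTail (m + 1) m p = (m + 1) * p ^ m - m * p ^ (m + 1) := by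
  rw [upperTail_eq_add (by omega), upperTail_self, B]
  simp
  ring

lemma continuous_B (n x : ℕ) : Continuous (B n x) := by unfold B; fun_prop

lemma integral_B {n x : ℕ} (hx : x ≤ n) : ∫ p in (0 : ℝ)..1, B n x p = 1 / (n + 1) := by
  have h := isBetaCDF_upperTail (Nat.succ_le_succ hx)
  have hd : ∀ p ∈ Set.uIcc (0 : ℝ) 1,
      HasDerivAt (fun p => upperTail (n + 1) (x + 1) p / (n + 1)) (B n x p) p := by
    intro p _
    refine ((hasDerivAt_upperTail (Nat.succ_le_succ hx) p).div_const _).congr_deriv ?_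
    have : (n : ℝ) + 1 ≠ 0 := by positivity
    simp only [B, betaKernel]
    push_cast
    field_simp
  rw [intervalIntegral.integral_eq_sub_of_hasDerivAt hd
    ((continuous_B n x).intervalIntegrable _ _), h.zero, h.one]
  simp

lemma B_one_sub {n x : ℕ} (hx : x ≤ n) (p : ℝ) : B n x (1 - p) = B n (n - x) p := by
  rw [B, B, Nat.choose_symm hx, Nat.sub_sub_self hx, sub_sub_cancel]
  ring

lemma sum_range_B_one_sub {n i : ℕ} (hi : i < n) (p : ℝ) :
    ∑ x ∈ Finset.range (i + 1), B n x (1 - p) = upperTail n (n - i) p := by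
  refine Finset.sum_nbij' (fun x => n - x) (fun x => n - x) ?_ ?_ ?_ ?_ ?_
  · intro x hx
    rw [Finset.mem_range] at hx
    rw [Finset.mem_Icc]; omega
  · intro x hx
    rw [Finset.mem_Icc] at hx
    rw [Finset.mem_range]; omega
  · intro x hx
    rw [Finset.mem_range] at hx
    omega
  · intro x hx
    rw [Finset.mem_Icc] at hx
    omega
  · intro x hx
    rw [Finset.mem_range] at hx
    exact B_one_sub (by omega) p

lemma integral_sum_mul_B (n : ℕ) (v : ℕ → ℝ) :
    ∫ p in (0 : ℝ)..1, ∑ x ∈ Finset.range (n + 1), v x * B n x p =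
      (∑ x ∈ Finset.range (n + 1), v x) / (n + 1) := by
  rw [intervalIntegral.integral_finsetSum fun x _ =>
    ((continuous_B n x).const_mul (v x)).intervalIntegrable _ _, Finset.sum_div]
  refine Finset.sum_congr rfl fun x hx => ?_
  rw [intervalIntegral.integral_const_mul, integral_B (by simpa [Nat.lt_succ_iff] using hx),
    mul_one_div]

lemma integral_lowerTail {n i : ℕ} (hi : i < n) (a b : ℝ) :
    ∫ p in a..b, ∑ x ∈ Finset.range (i + 1), B n x p =
      ∫ p in (1 - b)..(1 - a), upperTail n (n - i) p := by
  simp_rw [← sum_range_B_one_sub hi]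
  rw [intervalIntegral.integral_comp_sub_left
    (fun p => ∑ x ∈ Finset.range (i + 1), B n x p) 1]
  simp

lemma IsOLCLower.reflect {n : ℕ} {α : ℝ} {l : ℕ → ℝ} (h : IsOLCLower n α l) :
    IsOLCUpper n α fun x => 1 - l (n - x) := by
  obtain ⟨h0, hmono, hn, hint⟩ := h
  refine ⟨by simpa using hn, fun i hi => ?_, by simp [h0], fun i hi1 hin => ?_⟩
  · have := hmono (n - (i + 1)) (by omega)
    rw [show n - (i + 1) + 1 = n - i by omega] at this
    linarith
  · have := hint (n - i) (by omega)
    rw [integral_lowerTail (by omega), Nat.sub_sub_self hin,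
      show n - i + 1 = n - (i - 1) by omega] at this
    exact this.trans (by ring)

lemma IsLCCLower.reflect {n : ℕ} {α : ℝ} {l : ℕ → ℝ} (h : IsLCCLower n α l) :
    IsLCCUpper n α fun x => 1 - l (n - x) := by
  obtain ⟨h0, hmono, hn, hint⟩ := h
  refine ⟨by simpa using hn, fun i hi => ?_, by simp [h0], fun i hi1 hin => ?_⟩
  · have := hmono (n - (i + 1)) (by omega)
    rw [show n - (i + 1) + 1 = n - i by omega] at this
    linarith
  · have := hint (n - i) (by omega)
    rw [integral_lowerTail (by omega), Nat.sub_sub_self hin,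
      show n - i + 1 = n - (i - 1) by omega] at this
    exact le_trans (by ring_nf; rfl) this

/-- A finite sequence ending in zero, each negative term of which is compensated by its
successor, has nonnegative sum. -/
lemma sum_nonneg_of_compensated {n : ℕ} {d : ℕ → ℝ} (hn : d n = 0)
    (hneg : ∀ i < n, d (i + 1) ≤ 0 → 0 ≤ d i)
    (hpos : ∀ i, i + 1 < n → 0 ≤ d (i + 1) → -d (i + 1) ≤ d i) :
    0 ≤ ∑ x ∈ Finset.range (n + 1), d x := by
  have key : ∀ m ≤ n, 0 ≤ ∑ x ∈ Finset.Icc (n - m) n, d x ∧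
      d (n - m) ≤ ∑ x ∈ Finset.Icc (n - m) n, d x := by
    intro m hm
    induction m with
    | zero => simp [hn]
    | succ m ih =>
      obtain ⟨h0, h1⟩ := ih (by omega)
      obtain ⟨i, hi⟩ : ∃ i, i = n - (m + 1) := ⟨_, rfl⟩
      rw [show n - m = i + 1 by omega] at h0 h1
      rw [← hi, ← Finset.insert_Icc_add_one_left_eq_Icc (by omega : i ≤ n),
        Finset.sum_insert (by simp)]
      have : 0 ≤ d i ∨ -d (i + 1) ≤ d i := by
        rcases le_total (d (i + 1)) 0 with h | h
        · exact Or.inl (hneg i (by omega) h)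
        · rcases (show i + 1 = n ∨ i + 1 < n by omega) with h' | h'
          · exact Or.inl (hneg i (by omega) (by rw [h', hn]))
          · exact Or.inr (hpos i h' h)
      constructor
      · rcases this with h | h <;> linarith
      · linarith
  have := (key n le_rfl).1
  rwa [Nat.sub_self, ← Nat.range_succ_eq_Icc_zero] at this

lemma le_of_step_lt {n : ℕ} {u : ℕ → ℝ} (h : ∀ i, i < n → u i < u (i + 1)) {i j : ℕ}
    (hij : i ≤ j) (hj : j ≤ n) : u i ≤ u j := by
  induction j, hij using Nat.le_induction with
  | base => rfl
  | succ j _ ih => exact (ih (by omega)).trans (h j hj).le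

lemma two_mul_mode_pow_numerics :
    ∀ i < 64, 200 * i ^ (i + 1) ≤ 73 * (i + 1) ^ (i + 1) := by
  decide +kernel

lemma two_mul_mode_pow_le {i : ℕ} (hi : i < 64) :
    2 * ((i : ℝ) / (i + 1)) ^ (i + 1) ≤ 0.73 := by
  have h : (200 * i ^ (i + 1) : ℝ) ≤ 73 * (i + 1) ^ (i + 1) := by
    exact_mod_cast two_mul_mode_pow_numerics i hi
  rw [div_pow, mul_div_assoc', div_le_iff₀ (by positivity)]
  linarith

namespace IsOLCUpper

variable {n : ℕ} {α : ℝ} {u : ℕ → ℝ}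

lemma nonneg (hu : IsOLCUpper n α u) {i : ℕ} (hi : i ≤ n) : 0 ≤ u i :=
  hu.1.le.trans (le_of_step_lt hu.2.1 i.zero_le hi)

lemma le_one (hu : IsOLCUpper n α u) {i : ℕ} (hi : i ≤ n) : u i ≤ 1 :=
  (le_of_step_lt hu.2.1 hi le_rfl).trans hu.2.2.1.le

lemma integral_eq (hu : IsOLCUpper n α u) {i : ℕ} (hi : i < n) :
    ∫ p in (u i)..(u (i + 1)), (upperTail n (i + 1) p - (1 - α)) = 0 := by
  have h := hu.2.2.2 (i + 1) (by omega) hi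
  rw [intervalIntegral.integral_sub
    ((isBetaCDF_upperTail hi).continuous.intervalIntegrable _ _) (by simp)]
  rw [Nat.add_sub_cancel] at h
  rw [show ∫ p in (u i)..(u (i + 1)), upperTail n (i + 1) p = _ from h]
  simp
  ring

/-- Just below the mode of the density, either the endpoints of a step of the optimal sequence are
below the nominal level on average, or their midpoint is above it. -/
lemma endpoints_or_midpoint (hu : IsOLCUpper n α u) (hn : n ≤ 200) (hα : α < 0.27) {i : ℕ}
    (hi : i + 1 < n) (hc : 1 / 2 < (u i + u (i + 1)) / 2)
    (hm : (i + (n - (i + 1) : ℕ)) * ((u i + u (i + 1)) / 2) < i) :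
    upperTail n (i + 1) (u (i + 1)) + upperTail n (i + 1) (u i) < 2 * (1 - α) ∨
      1 - α < upperTail n (i + 1) ((u i + u (i + 1)) / 2) := by
  left
  have hF := isBetaCDF_upperTail hi.le
  have hJ0 : 1 ≤ n - (i + 1) := by omega
  obtain ⟨J, hJ⟩ : ∃ J, J = n - (i + 1) := ⟨_, rfl⟩
  rw [← hJ] at hF hm hJ0
  have hKJ : (0 : ℝ) < i + J := by
    have : (1 : ℝ) ≤ J := by exact_mod_cast hJ0
    positivity
  have ha := hu.nonneg (i := i) (by omega)
  have hb := hu.le_one (i := i + 1) (by omega)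
  have hab := hu.2.1 i (by omega)
  have hcm : (u i + u (i + 1)) / 2 < i / (i + J) := by
    rw [lt_div_iff₀ hKJ]; linarith
  by_cases hmode : upperTail n (i + 1) (i / (i + J)) < 1 - α
  · have := hF.symmSum_le_mode (c := (u i + u (i + 1)) / 2) (m := i / (i + J))
      (s := (u (i + 1) - u i) / 2) (by linarith)
      (div_le_one_of_le₀ (by linarith [J.cast_nonneg (α := ℝ)]) hKJ.le)
      (by rw [mul_div_cancel₀ _ hKJ.ne']) hcm.le (by linarith) (by linarith) (by linarith)
    rw [show (u i + u (i + 1)) / 2 + (u (i + 1) - u i) / 2 = u (i + 1) by ring,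
      show (u i + u (i + 1)) / 2 - (u (i + 1) - u i) / 2 = u i by ring] at this
    linarith
  have hJ1 : J = 1 := by
    by_contra hne
    have hJi : J ≤ i := by
      have : (J : ℝ) ≤ i := by
        have := mul_lt_mul_of_pos_left hc hKJ
        linarith
      exact_mod_cast this
    have := hF.mode_le (by omega) hJi
    linarith
  obtain rfl : n = i + 1 + 1 := by omega
  subst hJ1
  rw [not_lt] at hmode
  push_cast at hmode hm
  have hi64 : 64 ≤ i := by
    by_contra! h
    have h1 := two_mul_mode_pow_le h
    have h2 : upperTail (i + 1 + 1) (i + 1) (i / (i + 1)) = 2 * ((i : ℝ) / (i + 1)) ^ (i + 1) := by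
      rw [upperTail_pred, pow_succ _ (i + 1)]
      push_cast
      field_simp
      ring
    linarith
  obtain ⟨k, rfl⟩ := Nat.exists_eq_add_of_le' hi64
  push_cast at hmode hm
  have hlast := hu.integral_eq (i := k + 64 + 1) (by omega)
  have hun := hu.2.2.1
  have hb1 := hu.2.1 (k + 64 + 1) (by omega)
  rw [hun] at hlast hb1
  have heq : (1 - α) * (k + 67) * (1 - u (k + 64 + 1)) = 1 - u (k + 64 + 1) ^ (k + 67) := by
    rw [show upperTail (k + 64 + 1 + 1) (k + 64 + 1 + 1) = fun p => p ^ (k + 66) from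
      funext (upperTail_self _), intervalIntegral.integral_sub (by simp) (by simp),
      integral_pow] at hlast
    simp only [intervalIntegral.integral_const, smul_eq_mul, one_pow] at hlast
    push_cast at hlast
    have hk : (k : ℝ) + 66 + 1 ≠ 0 := by positivity
    field_simp at hlast
    linarith
  refine hF.add_lt_of_one (k := k) (by omega) (fun p => ?_) (by linarith) ?_ ha hab hb1 heq
    (hu.integral_eq (by omega)) ?_
  · rw [upperTail_pred]
    push_cast
    ring
  · rwa [show (k : ℝ) + 65 = k + 64 + 1 by ring]
  · linarith

/-- The optimal upper endpoints have the smallest sum among all locally correct ones. -/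
lemma sum_le (hu : IsOLCUpper n α u) (hn : n ≤ 200) (hα : α < 0.27) {v : ℕ → ℝ}
    (hv : IsLCCUpper n α v) :
    ∑ x ∈ Finset.range (n + 1), u x ≤ ∑ x ∈ Finset.range (n + 1), v x := by
  obtain ⟨hv0, hvmono, hvn, hvint⟩ := hv
  rw [← sub_nonneg, ← Finset.sum_sub_distrib]
  have hvnn : ∀ i ≤ n, 0 ≤ v i := fun i hi => hv0.le.trans (le_of_step_lt hvmono i.zero_le hi)
  have hv1 : ∀ i ≤ n, v i ≤ 1 := fun i hi => (le_of_step_lt hvmono hi le_rfl).trans hvn.le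
  have hvint' : ∀ i < n,
      0 ≤ ∫ p in (v i)..(v (i + 1)), (upperTail n (i + 1) p - (1 - α)) := by
    intro i hi
    have h := hvint (i + 1) (by omega) hi
    rw [intervalIntegral.integral_sub
      ((isBetaCDF_upperTail hi).continuous.intervalIntegrable _ _) (by simp)]
    rw [Nat.add_sub_cancel] at h
    rw [intervalIntegral.integral_const, smul_eq_mul, sub_nonneg, mul_comm]
    exact h
  refine sum_nonneg_of_compensated (by rw [hvn, hu.2.2.1, sub_self]) (fun i hi h => ?_)
    fun i hi h => ?_
  · rw [sub_nonneg]
    exact (isBetaCDF_upperTail hi).left_le_of_right_le (hu.nonneg hi.le) (hu.2.1 i hi)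
      (hu.le_one hi) (hu.integral_eq hi) (hvnn i hi.le) (hvmono i hi) (by linarith)
      (hvint' i hi)
  · have hi' : i < n := by omega
    have := (isBetaCDF_upperTail hi').left_sub_le (by linarith) (hu.nonneg hi'.le)
      (hu.2.1 i hi') (hu.integral_eq hi') (hu.endpoints_or_midpoint hn hα hi) (hvnn i hi'.le)
      (by linarith) (hv1 _ hi') (hvint' i hi')
    linarith

end IsOLCUpper

theorem stmt_4 (n : ℕ) (hn1 : 1 ≤ n) (hn2 : n ≤ 200)
    (α : ℝ) (hα1 : (0.0001 : ℝ) < α) (hα2 : α < 0.27)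
    (u l : ℕ → ℝ) (hu : IsOLCUpper n α u) (hl : IsOLCLower n α l)
    (u' l' : ℕ → ℝ) (hu' : IsLCCUpper n α u') (hl' : IsLCCLower n α l') :
    (∫ p in (0:ℝ)..1, ∑ x ∈ Finset.range (n + 1), (u x - l x) * B n x p)
      ≤ ∫ p in (0:ℝ)..1, ∑ x ∈ Finset.range (n + 1), (u' x - l' x) * B n x p := by
  rw [integral_sum_mul_B n fun x => u x - l x, integral_sum_mul_B n fun x => u' x - l' x]
  have h1 := hu.sum_le hn2 hα2 hu'
  have h2 := hl.reflect.sum_le hn2 hα2 hl'.reflect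
  have hr : ∀ m : ℕ → ℝ, ∑ x ∈ Finset.range (n + 1), (1 - m (n - x)) =
      ∑ x ∈ Finset.range (n + 1), (1 - m x) := fun m =>
    Finset.sum_range_reflect (fun x => 1 - m x) (n + 1)
  rw [hr, hr] at h2
  simp only [Finset.sum_sub_distrib] at h2 ⊢
  exact div_le_div_of_nonneg_right (by linarith) (by positivity)
end

section
/- Let n be an integer with 1 ≤ n ≤ 200 and let α satisfy 0.0001 < α < 0.27. Let 0 ≤ j ≤ n−1 and suppose real numbers 0 = l_0 < l_1 < ⋯ < l_j < 1 satisfy ∫_{l_i}^{l_{i+1}} Σ_{x=0}^{i} B(n,x,p) dp = (1−α)(l_{i+1} − l_i) for every i = 0,…,j−1. Then there exists a unique real number b with l_j < b < 1 such that ∫_{l_j}^{b} Σ_{x=0}^{j} B(n,x,p) dp = (1−α)(b − l_j). -/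
open MeasureTheory

/-- The upper tail `P(Bin(n,p) ≥ k)`. -/
noncomputable def binTail (n k : ℕ) (p : ℝ) : ℝ := 1 - ∑ x ∈ Finset.range k, B n x p

/-- The density of the `k`-th order statistic of `n` uniform variables. -/
noncomputable def orderDensity (n k : ℕ) (p : ℝ) : ℝ :=
  k * n.choose k * p ^ (k - 1) * (1 - p) ^ (n - k)

theorem binTail_succ (n k : ℕ) (p : ℝ) : binTail n k p = binTail n (k + 1) p + B n k p := by
  simp only [binTail, Finset.sum_range_succ]
  ring

theorem hasDerivAt_B_s15 (n x : ℕ) (p : ℝ) :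
    HasDerivAt (B n x) (orderDensity n x p - orderDensity n (x + 1) p) p := by
  have h1 : HasDerivAt (fun p : ℝ => p ^ x) (x * p ^ (x - 1)) p := hasDerivAt_pow x p
  have h2 : HasDerivAt (fun p : ℝ => (1 - p) ^ (n - x))
      ((n - x : ℕ) * (1 - p) ^ (n - x - 1) * (-1)) p :=
    ((hasDerivAt_id p).const_sub 1).pow (n - x)
  have hc : ((n.choose (x + 1) : ℕ) : ℝ) * ((x + 1 : ℕ) : ℝ)
      = (n.choose x : ℝ) * ((n - x : ℕ) : ℝ) := by
    exact_mod_cast Nat.choose_succ_right_eq n x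
  refine ((h1.const_mul (n.choose x : ℝ)).mul h2).congr_deriv ?_
  have e : n - (x + 1) = n - x - 1 := by omega
  simp only [orderDensity, e, Nat.add_sub_cancel]
  linear_combination (p ^ x * (1 - p) ^ (n - x - 1)) * hc

theorem hasDerivAt_binTail (n k : ℕ) (p : ℝ) :
    HasDerivAt (binTail n k) (orderDensity n k p) p := by
  induction k with
  | zero =>
    have : binTail n 0 = fun _ => 1 := by funext q; simp [binTail]
    rw [this]
    simpa [orderDensity] using hasDerivAt_const p (1 : ℝ)
  | succ k ih =>
    have : binTail n (k + 1) = fun q => binTail n k q - B n k q := by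
      funext q
      rw [binTail_succ n k]
      ring
    rw [this]
    exact (ih.sub (hasDerivAt_B_s15 n k p)).congr_deriv (by ring)

theorem continuous_binTail (n k : ℕ) : Continuous (binTail n k) :=
  continuous_iff_continuousAt.2 fun p => (hasDerivAt_binTail n k p).continuousAt

theorem binTail_at_zero (n k : ℕ) (hk : 1 ≤ k) : binTail n k 0 = 0 := by
  obtain ⟨k, rfl⟩ := Nat.exists_eq_add_of_le' hk
  simp [binTail, Finset.sum_range_succ', B]

theorem binTail_at_one (n k : ℕ) (hk : k ≤ n) : binTail n k 1 = 1 := by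
  have : ∑ x ∈ Finset.range k, B n x 1 = 0 := by
    refine Finset.sum_eq_zero fun x hx => ?_
    have : n - x ≠ 0 := by have := Finset.mem_range.1 hx; omega
    simp [B, this]
  simp [binTail, this]

theorem orderDensity_pos {n k : ℕ} (hk : 1 ≤ k) (hkn : k ≤ n) {p : ℝ} (hp : p ∈ Set.Ioo (0 : ℝ) 1) :
    0 < orderDensity n k p := by
  have h1 : (0 : ℝ) < k := by exact_mod_cast hk
  have h2 : (0 : ℝ) < n.choose k := by exact_mod_cast Nat.choose_pos hkn
  have h3 : 0 < 1 - p := by linarith [hp.2]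
  have h4 := hp.1
  unfold orderDensity
  positivity

theorem strictMonoOn_binTail {n k : ℕ} (hk : 1 ≤ k) (hkn : k ≤ n) :
    StrictMonoOn (binTail n k) (Set.Icc 0 1) := by
  refine strictMonoOn_of_deriv_pos (convex_Icc 0 1) (continuous_binTail n k).continuousOn ?_
  intro p hp
  rw [interior_Icc] at hp
  rw [(hasDerivAt_binTail n k p).deriv]
  exact orderDensity_pos hk hkn hp

/-- A differentiable increasing bijection of the unit interval has a differentiable inverse. -/
theorem exists_inverse_on_unit_interval {f f' : ℝ → ℝ} (hf : ∀ p, HasDerivAt f (f' p) p)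
    (hpos : ∀ p ∈ Set.Ioo (0 : ℝ) 1, 0 < f' p) (h0 : f 0 = 0) (h1 : f 1 = 1)
    (hmono : StrictMonoOn f (Set.Icc 0 1)) :
    ∃ q : ℝ → ℝ, q 0 = 0 ∧ ContinuousOn q (Set.Icc 0 1) ∧
      (∀ u ∈ Set.Icc (0 : ℝ) 1, q u ∈ Set.Icc (0 : ℝ) 1 ∧ f (q u) = u) ∧
      ∀ u ∈ Set.Ioo (0 : ℝ) 1, q u ∈ Set.Ioo (0 : ℝ) 1 ∧ HasDerivAt q (f' (q u))⁻¹ u := by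
  have hcont : Continuous f := continuous_iff_continuousAt.2 fun p => (hf p).continuousAt
  have hsurj : Set.SurjOn f (Set.Icc 0 1) (Set.Icc 0 1) := by
    have := intermediate_value_Icc (zero_le_one' ℝ) hcont.continuousOn
    rwa [h0, h1] at this
  set q := Function.invFunOn f (Set.Icc (0 : ℝ) 1) with hq
  have hmem : ∀ u ∈ Set.Icc (0 : ℝ) 1, q u ∈ Set.Icc (0 : ℝ) 1 := fun u hu =>
    Function.invFunOn_mem (hsurj hu)
  have hinv : ∀ u ∈ Set.Icc (0 : ℝ) 1, f (q u) = u := fun u hu =>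
    Function.invFunOn_eq (hsurj hu)
  have hq0 : q 0 = 0 := by
    have h : (0 : ℝ) ∈ Set.Icc (0 : ℝ) 1 := by simp
    exact hmono.injOn (hmem 0 h) h ((hinv 0 h).trans h0.symm)
  have hmaps : ∀ p ∈ Set.Icc (0 : ℝ) 1, f p ∈ Set.Icc (0 : ℝ) 1 := fun p hp =>
    ⟨h0 ▸ hmono.monotoneOn (by simp) hp hp.1, h1 ▸ hmono.monotoneOn hp (by simp) hp.2⟩
  have hleft : ∀ p ∈ Set.Icc (0 : ℝ) 1, q (f p) = p := fun p hp =>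
    hmono.injOn (hmem _ (hmaps p hp)) hp (hinv _ (hmaps p hp))
  have hqmono : StrictMonoOn q (Set.Icc 0 1) := fun u hu v hv huv =>
    (hmono.lt_iff_lt (hmem u hu) (hmem v hv)).1 (by rwa [hinv u hu, hinv v hv])
  have hqcont : ContinuousOn q (Set.Icc 0 1) := by
    have h : Continuous (Set.MapsTo.restrict q _ _ hmem) := by
      refine Monotone.continuous_of_surjective (fun u v huv => ?_) fun p => ?_
      · exact hqmono.monotoneOn u.2 v.2 huv
      · exact ⟨⟨f p, hmaps p p.2⟩, Subtype.ext (hleft p p.2)⟩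
    exact continuousOn_iff_continuous_domRestrict.2 (continuous_subtype_val.comp h)
  refine ⟨q, hq0, hqcont, fun u hu => ⟨hmem u hu, hinv u hu⟩, fun u hu => ?_⟩
  have hu' := Set.Ioo_subset_Icc_self hu
  have hqu : q u ∈ Set.Ioo (0 : ℝ) 1 := by
    refine ⟨lt_of_le_of_ne (hmem u hu').1 fun h => ?_, lt_of_le_of_ne (hmem u hu').2 fun h => ?_⟩
    · have := hinv u hu'
      rw [← h, h0] at this
      exact hu.1.ne this
    · have := hinv u hu'
      rw [h, h1] at this
      exact hu.2.ne' this
  have hnhds : Set.Icc (0 : ℝ) 1 ∈ nhds u := Icc_mem_nhds hu.1 hu.2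
  refine ⟨hqu, HasDerivAt.of_local_left_inverse (hqcont.continuousAt hnhds) (hf _)
    (hpos _ hqu).ne' ?_⟩
  filter_upwards [hnhds] with v hv using hinv v hv

/-- A function vanishing at `0`, nonnegative at `w`, all of whose critical points in `(0, w)` with
nonpositive value are strict local maxima, is positive on `(0, w)`. -/
theorem pos_of_critical_points {E M : ℝ → ℝ} {w : ℝ} (hE : ContinuousOn E (Set.Icc 0 w))
    (h0 : E 0 = 0) (hw : 0 ≤ E w) (hderiv : ∀ u ∈ Set.Ioo 0 w, HasDerivAt E (M u) u)
    (hcrit : ∀ u ∈ Set.Ioo 0 w, M u = 0 → E u ≤ 0 → ∃ M' < 0, HasDerivAt M M' u) :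
    ∀ u ∈ Set.Ioo 0 w, 0 < E u := by
  intro v hv
  by_contra! hneg
  obtain ⟨c, hc, hcneg, hmin⟩ : ∃ c ∈ Set.Ioo 0 w, E c ≤ 0 ∧ IsMinOn E (Set.Icc 0 w) c := by
    obtain ⟨c, hc, hmin⟩ := isCompact_Icc.exists_isMinOn ⟨v, Set.Ioo_subset_Icc_self hv⟩ hE
    have hcv : E c ≤ E v := hmin (Set.Ioo_subset_Icc_self hv)
    by_cases hend : c = 0 ∨ c = w
    · have hc0 : 0 ≤ E c := by
        rcases hend with rfl | rfl
        · exact h0.ge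
        · exact hw
      exact ⟨v, hv, hneg, fun x hx => (hneg.trans hc0).trans (hmin hx)⟩
    · push Not at hend
      exact ⟨c, ⟨lt_of_le_of_ne hc.1 hend.1.symm, lt_of_le_of_ne hc.2 hend.2⟩,
        hcv.trans hneg, hmin⟩
  have hnhds : Set.Ioo 0 w ∈ nhds c := Ioo_mem_nhds hc.1 hc.2
  have hlmin : IsLocalMin E c := hmin.isLocalMin (Icc_mem_nhds hc.1 hc.2)
  have hM0 : M c = 0 := hlmin.hasDerivAt_eq_zero (hderiv c hc)
  obtain ⟨M', hM', hMd⟩ := hcrit c hc hM0 hcneg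
  have hEM : deriv E =ᶠ[nhds c] M := by
    filter_upwards [hnhds] with u hu using (hderiv u hu).deriv
  have hlmax : IsLocalMax E c := by
    refine isLocalMax_of_deriv_deriv_neg ?_ ?_ (hderiv c hc).continuousAt
    · rw [hEM.deriv_eq, hMd.deriv]
      exact hM'
    · rw [hEM.eq_of_nhds, hM0]
  have hconst : E =ᶠ[nhds c] fun _ => E c := by
    filter_upwards [hlmin, hlmax] with u h1 h2 using le_antisymm h2 h1
  have hMzero : M =ᶠ[nhds c] fun _ => 0 := by
    have := hEM.symm.trans hconst.deriv
    simpa using this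
  have := (hMd.congr_of_eventuallyEq hMzero.symm).unique (hasDerivAt_const c (0 : ℝ))
  exact hM'.ne this

/-- `orderDensity n k p * p * (1 - p)`. -/
noncomputable def orderWeight (n k : ℕ) (p : ℝ) : ℝ :=
  k * n.choose k * p ^ k * (1 - p) ^ (n - k + 1)

theorem orderWeight_eq {n k : ℕ} (hk : 1 ≤ k) (p : ℝ) :
    orderWeight n k p = p * (1 - p) * orderDensity n k p := by
  obtain ⟨k, rfl⟩ := Nat.exists_eq_add_of_le' hk
  simp only [orderWeight, orderDensity, Nat.add_sub_cancel]
  ring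

theorem hasDerivAt_orderWeight {n k : ℕ} (hk : 1 ≤ k) (hkn : k ≤ n) (p : ℝ) :
    HasDerivAt (orderWeight n k) (orderDensity n k p * (k - (n + 1) * p)) p := by
  obtain ⟨k, rfl⟩ := Nat.exists_eq_add_of_le' hk
  obtain ⟨m, rfl⟩ := Nat.exists_eq_add_of_le hkn
  have h1 : HasDerivAt (fun p : ℝ => p ^ (k + 1)) ((k + 1 : ℕ) * p ^ k) p :=
    hasDerivAt_pow (k + 1) p
  have h2 : HasDerivAt (fun p : ℝ => (1 - p) ^ (m + 1)) ((m + 1 : ℕ) * (1 - p) ^ m * (-1)) p :=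
    ((hasDerivAt_id p).const_sub 1).pow (m + 1)
  have h3 := (h1.const_mul (((k + 1 : ℕ) : ℝ) * ((k + 1 + m).choose (k + 1) : ℝ))).mul h2
  have e : k + 1 + m - (k + 1) = m := by omega
  have hfun : orderWeight (k + 1 + m) (k + 1) = (fun p : ℝ => ((k + 1 : ℕ) : ℝ) *
      ((k + 1 + m).choose (k + 1) : ℝ) * p ^ (k + 1)) * fun p : ℝ => (1 - p) ^ (m + 1) := by
    funext p
    simp only [orderWeight, e, Pi.mul_apply]
  rw [hfun]
  refine h3.congr_deriv ?_
  simp only [orderDensity, e, Nat.add_sub_cancel]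
  push_cast
  ring

/-- An antiderivative of `binTail n k`. -/
noncomputable def binTailPrimitive (n k : ℕ) (p : ℝ) : ℝ :=
  (p - k / (n + 1)) * binTail n k p + orderWeight n k p / (n + 1)

theorem hasDerivAt_binTailPrimitive {n k : ℕ} (hk : 1 ≤ k) (hkn : k ≤ n) (p : ℝ) :
    HasDerivAt (binTailPrimitive n k) (binTail n k p) p := by
  have hN : (n : ℝ) + 1 ≠ 0 := by positivity
  refine ((((hasDerivAt_id p).sub_const ((k : ℝ) / (n + 1))).mul (hasDerivAt_binTail n k p)).add
    ((hasDerivAt_orderWeight hk hkn p).div_const ((n : ℝ) + 1))).congr_deriv ?_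
  simp only [id]
  field_simp
  ring

theorem integral_binTail_sub {n k : ℕ} (hk : 1 ≤ k) (hkn : k ≤ n) (α a b : ℝ) :
    ∫ p in a..b, (binTail n k p - α)
      = binTailPrimitive n k b - α * b - (binTailPrimitive n k a - α * a) := by
  refine intervalIntegral.integral_eq_sub_of_hasDerivAt
    (f := fun p => binTailPrimitive n k p - α * p) (fun p _ => ?_)
    (((continuous_binTail n k).sub continuous_const).intervalIntegrable a b)
  exact ((hasDerivAt_binTailPrimitive hk hkn p).sub ((hasDerivAt_id p).const_mul α)).congr_deriv
    (by simp)

/-- The contribution of a right endpoint, the `α`-quantile of order `k + 1`. -/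
theorem binTailPrimitive_right {n k : ℕ} {α b : ℝ}
    (hb : binTail n (k + 1) b = α) :
    (n + 1) * (binTailPrimitive n k b - α * b) = (n + 1 - k) * (b * B n k b) - α * k := by
  have hN : (n : ℝ) + 1 ≠ 0 := by positivity
  have hw : orderWeight n k b = k * (1 - b) * B n k b := by
    simp only [orderWeight, B]
    ring
  rw [binTailPrimitive, binTail_succ, hb, hw]
  field_simp
  ring

/-- The contribution of a left endpoint, the `α`-quantile of order `k`. -/
theorem binTailPrimitive_left {n k : ℕ} (hkn : k + 1 ≤ n) {α a : ℝ}
    (ha : binTail n k a = α) :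
    (n + 1) * (binTailPrimitive n (k + 1) a - α * a)
      = (k + 1) * ((1 - a) * B n k a) - α * (k + 1) := by
  have hN : (n : ℝ) + 1 ≠ 0 := by positivity
  have hc : ((n.choose (k + 1) : ℕ) : ℝ) * ((k + 1 : ℕ) : ℝ)
      = (n.choose k : ℝ) * ((n - k : ℕ) : ℝ) := by
    exact_mod_cast Nat.choose_succ_right_eq n k
  obtain ⟨m, rfl⟩ := Nat.exists_eq_add_of_le hkn
  have e1 : k + 1 + m - (k + 1) = m := by omega
  have e2 : k + 1 + m - k = m + 1 := by omega
  have ht := binTail_succ (k + 1 + m) k a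
  rw [e2] at hc
  have hw : orderWeight (k + 1 + m) (k + 1) a = (m + 1) * a * B (k + 1 + m) k a := by
    simp only [orderWeight, B, e1, e2]
    push_cast at hc ⊢
    linear_combination (a ^ (k + 1) * (1 - a) ^ (m + 1)) * hc
  have ht' : binTail (k + 1 + m) (k + 1) a = α - B (k + 1 + m) k a := by linarith
  rw [binTailPrimitive, hw, ht']
  push_cast
  field_simp
  ring

theorem exists_quantile {n k : ℕ} (hk : 1 ≤ k) (hkn : k ≤ n) :
    ∃ q : ℝ → ℝ, q 0 = 0 ∧ ContinuousOn q (Set.Icc 0 1) ∧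
      (∀ u ∈ Set.Icc (0 : ℝ) 1, q u ∈ Set.Icc (0 : ℝ) 1 ∧ binTail n k (q u) = u) ∧
      ∀ u ∈ Set.Ioo (0 : ℝ) 1, q u ∈ Set.Ioo (0 : ℝ) 1 ∧
        HasDerivAt q (orderDensity n k (q u))⁻¹ u :=
  exists_inverse_on_unit_interval (hasDerivAt_binTail n k)
    (fun _ hp => orderDensity_pos hk hkn hp) (binTail_at_zero n k hk) (binTail_at_one n k hkn)
    (strictMonoOn_binTail hk hkn)

theorem hasDerivAt_orderWeight_quantile {n k : ℕ} (hk : 1 ≤ k) (hkn : k ≤ n) {q : ℝ → ℝ} {u : ℝ}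
    (hmem : q u ∈ Set.Ioo (0 : ℝ) 1) (hq : HasDerivAt q (orderDensity n k (q u))⁻¹ u) :
    HasDerivAt (fun u => orderWeight n k (q u)) (k - (n + 1) * q u) u := by
  have hd := (orderDensity_pos hk hkn hmem).ne'
  refine ((hasDerivAt_orderWeight hk hkn (q u)).comp u hq).congr_deriv ?_
  field_simp

theorem continuous_orderWeight (n k : ℕ) : Continuous (orderWeight n k) := by
  unfold orderWeight
  fun_prop

theorem orderWeight_at_zero {n k : ℕ} (hk : 1 ≤ k) : orderWeight n k 0 = 0 := by
  have : k ≠ 0 := by omega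
  simp [orderWeight, this]

theorem orderWeight_monotoneOn {n k : ℕ} (hk : 1 ≤ k) (hkn : k ≤ n) {a b : ℝ} (ha : 0 ≤ a)
    (hab : a ≤ b) (hb : (n + 1) * b ≤ k) : orderWeight n k a ≤ orderWeight n k b := by
  have hkn' : (k : ℝ) ≤ n := by exact_mod_cast hkn
  refine monotoneOn_of_deriv_nonneg (convex_Icc 0 b) (continuous_orderWeight n k).continuousOn
    (fun p _ => (hasDerivAt_orderWeight hk hkn p).differentiableAt.differentiableWithinAt) ?_
    ⟨ha, hab⟩ ⟨ha.trans hab, le_rfl⟩ hab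
  intro p hp
  rw [interior_Icc] at hp
  have hb1 : b < 1 := by
    by_contra! h
    nlinarith
  rw [(hasDerivAt_orderWeight hk hkn p).deriv]
  refine mul_nonneg (orderDensity_pos hk hkn ⟨hp.1, hp.2.trans hb1⟩).le ?_
  nlinarith [hp.2]

/-- The inequality that makes every critical point below the line a strict local maximum. -/
theorem weighted_variance_lt {j m a b : ℝ} (hj : 0 < j) (hm : 1 < m)
    (hcrit : m / (m - 1) * (j + 2 - (j + m + 1) * b) = (j + 1) / j * (j - (j + m + 1) * a))
    (hline : j * (m - 1 - j) < (j - (j + m + 1) * a) * (j + 1) * (j + m - 1)) :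
    ((j + 1) / j) ^ 2 * (a * (1 - a)) < (m / (m - 1)) ^ 2 * (b * (1 - b)) := by
  have hm1 : 0 < m - 1 := by linarith
  set w := (j + 1) / j * (j - (j + m + 1) * a) with hw
  have hN : 0 < j + m + 1 := by linarith
  have ha : a = (j - j / (j + 1) * w) / (j + m + 1) := by
    rw [hw]
    field_simp
    ring
  have hb : b = (j + 2 - (m - 1) / m * w) / (j + m + 1) := by
    rw [← hcrit]
    field_simp
    ring
  have hpos : 0 < j + 1 - m + w * (j + m - 1) := by
    have : j * (j + 1 - m + w * (j + m - 1))
        = (j - (j + m + 1) * a) * (j + 1) * (j + m - 1) - j * (m - 1 - j) := by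
      rw [hw]
      field_simp
      ring
    have h2 : 0 < j * (j + 1 - m + w * (j + m - 1)) := by rw [this]; linarith
    exact pos_of_mul_pos_right h2 hj.le
  have hdiff : (m / (m - 1)) ^ 2 * (b * (1 - b)) - ((j + 1) / j) ^ 2 * (a * (1 - a))
      = (j + 1 - m + w * (j + m - 1)) / (j * (m - 1) * (j + m + 1)) := by
    rw [ha, hb]
    field_simp
    ring
  have : 0 < (j + 1 - m + w * (j + m - 1)) / (j * (m - 1) * (j + m + 1)) := by positivity
  linarith

theorem orderDensity_inv_lt {ca cb X Y da db : ℝ} (hca : 0 < ca) (hcb : 0 < cb) (hY : 0 < Y)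
    (hda : 0 < da) (hdb : 0 < db) (hle : cb * (Y * db) ≤ ca * (X * da))
    (hlt : ca ^ 2 * X < cb ^ 2 * Y) : ca * da⁻¹ < cb * db⁻¹ := by
  rw [← div_eq_mul_inv, ← div_eq_mul_inv, div_lt_div_iff₀ hda hdb]
  have h1 : ca * (cb * (Y * db)) ≤ ca * (ca * (X * da)) := mul_le_mul_of_nonneg_left hle hca.le
  have h2 : ca ^ 2 * X * da < cb ^ 2 * Y * da := mul_lt_mul_of_pos_right hlt hda
  have h3 : (ca * db) * (cb * Y) < (cb * da) * (cb * Y) := by linarith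
  exact lt_of_mul_lt_mul_right h3 (by positivity)

theorem interior_weight_pos {j m : ℕ} (hj : 1 ≤ j) (hm : 2 ≤ m) {a₁ b₁ : ℝ}
    (ha₁ : a₁ ∈ Set.Ioo (0 : ℝ) 1) (hb₁ : b₁ ∈ Set.Ioo (0 : ℝ) 1)
    (htail : binTail (j + m) (j + 2) b₁ ≤ binTail (j + m) j a₁)
    (hweight : (j + 1) ^ 2 * (a₁ ^ j * (1 - a₁) ^ (m + 1))
      ≤ m ^ 2 * (b₁ ^ (j + 2) * (1 - b₁) ^ (m - 1)))
    (hmode : (j + m + 1) * a₁ ≤ j)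
    (hline : (j : ℝ) * (m - 1 - j) ≤ (j - (j + m + 1) * a₁) * (j + 1) * (j + m - 1))
    {α a b : ℝ} (hα : 0 < α) (hα₁ : α < binTail (j + m) (j + 2) b₁)
    (ha : a ∈ Set.Icc (0 : ℝ) 1) (hb : b ∈ Set.Icc (0 : ℝ) 1)
    (hta : binTail (j + m) j a = α) (htb : binTail (j + m) (j + 2) b = α) :
    0 < (m : ℝ) / (m - 1) * orderWeight (j + m) (j + 2) b
      - (j + 1) / j * orderWeight (j + m) j a := by
  set n := j + m with hn
  have hnR : (n : ℝ) = j + m := by simp [hn]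
  have hjn : j ≤ n := by omega
  have hj2 : 1 ≤ j + 2 := by omega
  have hj2n : j + 2 ≤ n := by omega
  have hjR : (1 : ℝ) ≤ j := by exact_mod_cast hj
  have hmR : (2 : ℝ) ≤ m := by exact_mod_cast hm
  have hm1 : (0 : ℝ) < m - 1 := by linarith
  have hca : (0 : ℝ) < (j + 1) / j := by positivity
  have hcb : (0 : ℝ) < m / (m - 1) := by positivity
  have hmonoA := strictMonoOn_binTail hj hjn
  have hmonoB := strictMonoOn_binTail hj2 hj2n
  obtain ⟨qa, qa0, qac, qav, qad⟩ := exists_quantile hj hjn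
  obtain ⟨qb, qb0, qbc, qbv, qbd⟩ := exists_quantile hj2 hj2n
  have ha₁' := Set.Ioo_subset_Icc_self ha₁
  have hb₁' := Set.Ioo_subset_Icc_self hb₁
  set w := binTail n (j + 2) b₁ with hw
  have hw1 : w < 1 := by
    rw [hw, ← binTail_at_one n (j + 2) hj2n]
    exact hmonoB hb₁' (by simp) hb₁.2
  have hw0 : 0 < w := hα.trans hα₁
  have hsub : Set.Icc 0 w ⊆ Set.Icc 0 1 := Set.Icc_subset_Icc_right hw1.le
  have hsubo : Set.Ioo 0 w ⊆ Set.Ioo 0 1 := Set.Ioo_subset_Ioo_right hw1.le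
  have hqaα : qa α = a := by
    have hmem : α ∈ Set.Icc (0 : ℝ) 1 := ⟨hα.le, (hα₁.trans hw1).le⟩
    exact hmonoA.injOn (qav α hmem).1 ha ((qav α hmem).2.trans hta.symm)
  have hqbα : qb α = b := by
    have hmem : α ∈ Set.Icc (0 : ℝ) 1 := ⟨hα.le, (hα₁.trans hw1).le⟩
    exact hmonoB.injOn (qbv α hmem).1 hb ((qbv α hmem).2.trans htb.symm)
  have hwmem : w ∈ Set.Icc (0 : ℝ) 1 := ⟨hw0.le, hw1.le⟩
  have hqbw : qb w = b₁ := hmonoB.injOn (qbv w hwmem).1 hb₁' (qbv w hwmem).2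
  have hqaw : qa w ≤ a₁ := by
    refine (hmonoA.le_iff_le (qav w hwmem).1 ha₁').1 ?_
    rw [(qav w hwmem).2]
    exact htail
  have key := pos_of_critical_points
    (E := fun u => (m : ℝ) / (m - 1) * orderWeight n (j + 2) (qb u)
      - (j + 1) / j * orderWeight n j (qa u))
    (M := fun u => (m : ℝ) / (m - 1) * (j + 2 - (j + m + 1) * qb u)
      - (j + 1) / j * (j - (j + m + 1) * qa u)) (w := w)
    ?_ ?_ ?_ ?_ ?_ α ⟨hα, hα₁⟩
  · simpa only [hqaα, hqbα] using key
  · have h1 := (continuous_orderWeight n (j + 2)).comp_continuousOn (qbc.mono hsub)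
    have h2 := (continuous_orderWeight n j).comp_continuousOn (qac.mono hsub)
    exact (continuousOn_const.mul h1).sub (continuousOn_const.mul h2)
  · simp [qa0, qb0, orderWeight_at_zero hj, orderWeight_at_zero hj2]
  · have hmon := orderWeight_monotoneOn hj hjn (qav w hwmem).1.1 hqaw (by rwa [hnR])
    have hc1 : ((n.choose (j + 1) : ℕ) : ℝ) * ((j + 1 : ℕ) : ℝ)
        = (n.choose j : ℝ) * ((n - j : ℕ) : ℝ) := by
      exact_mod_cast Nat.choose_succ_right_eq n j
    have hc2 : ((n.choose (j + 2) : ℕ) : ℝ) * ((j + 2 : ℕ) : ℝ)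
        = (n.choose (j + 1) : ℝ) * ((n - (j + 1) : ℕ) : ℝ) := by
      exact_mod_cast Nat.choose_succ_right_eq n (j + 1)
    have e1 : n - j = m := by omega
    have e2 : n - (j + 1) = m - 1 := by omega
    have e3 : n - (j + 2) + 1 = m - 1 := by omega
    have e4 : ((m - 1 : ℕ) : ℝ) = m - 1 := by push_cast [Nat.cast_sub (by omega : 1 ≤ m)]; ring
    rw [e1] at hc1
    rw [e2, e4] at hc2
    push_cast at hc1 hc2
    have hcn : (n.choose (j + 1) : ℝ) = n.choose j * m / (j + 1) := by
      field_simp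
      linarith
    have hA : (j + 1 : ℝ) / j * orderWeight n j a₁
        = n.choose j / (j + 1) * ((j + 1) ^ 2 * (a₁ ^ j * (1 - a₁) ^ (m + 1))) := by
      simp only [orderWeight, e1]
      field_simp
    have hB : (m : ℝ) / (m - 1) * orderWeight n (j + 2) b₁
        = n.choose j / (j + 1) * (m ^ 2 * (b₁ ^ (j + 2) * (1 - b₁) ^ (m - 1))) := by
      simp only [orderWeight, e3]
      push_cast
      rw [mul_comm ((j : ℝ) + 2), hc2, hcn]
      field_simp
    have h3 := mul_le_mul_of_nonneg_left hmon hca.le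
    have h4 := mul_le_mul_of_nonneg_left hweight
      (by positivity : (0 : ℝ) ≤ n.choose j / (j + 1))
    simp only [hqbw]
    linarith
  · intro u hu
    have h1 := hasDerivAt_orderWeight_quantile hj2 hj2n (qbd u (hsubo hu)).1 (qbd u (hsubo hu)).2
    have h2 := hasDerivAt_orderWeight_quantile hj hjn (qad u (hsubo hu)).1 (qad u (hsubo hu)).2
    refine ((h1.const_mul ((m : ℝ) / (m - 1))).sub
      (h2.const_mul ((j + 1 : ℝ) / j))).congr_deriv ?_
    rw [hnR]
    push_cast
    ring
  · intro u hu hM hE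
    obtain ⟨hbm, hbd⟩ := qbd u (hsubo hu)
    obtain ⟨ham, had⟩ := qad u (hsubo hu)
    have hda := orderDensity_pos hj hjn ham
    have hdb := orderDensity_pos hj2 hj2n hbm
    refine ⟨(m : ℝ) / (m - 1) * (0 - (j + m + 1) * (orderDensity n (j + 2) (qb u))⁻¹)
      - (j + 1) / j * (0 - (j + m + 1) * (orderDensity n j (qa u))⁻¹), ?_, ?_⟩
    · have hlt : qa u < a₁ := by
        refine (hmonoA.lt_iff_lt (Set.Ioo_subset_Icc_self ham) ha₁').1 ?_
        rw [(qav u (hsub (Set.Ioo_subset_Icc_self hu))).2]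
        exact hu.2.trans_le htail
      have hvar := weighted_variance_lt (j := j) (m := m) (a := qa u) (b := qb u) (by linarith)
        (by linarith) (by linarith) (by
          refine hline.trans_lt ?_
          gcongr
          linarith)
      simp only [orderWeight_eq hj, orderWeight_eq hj2] at hE
      have hinv := orderDensity_inv_lt hca hcb
        (mul_pos hbm.1 (sub_pos.2 hbm.2)) hda hdb (by linarith) hvar
      have hN : (0 : ℝ) < j + m + 1 := by positivity
      have := mul_lt_mul_of_pos_left hinv hN
      linarith
    · exact ((((hbd.const_mul ((j : ℝ) + m + 1)).const_sub _).const_mul _).sub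
        (((had.const_mul ((j : ℝ) + m + 1)).const_sub _).const_mul _)).congr_deriv (by ring)

theorem integral_interior_pos {j m : ℕ} (hj : 1 ≤ j) (hm : 2 ≤ m) {a₁ b₁ : ℝ}
    (ha₁ : a₁ ∈ Set.Ioo (0 : ℝ) 1) (hb₁ : b₁ ∈ Set.Ioo (0 : ℝ) 1)
    (htail : binTail (j + m) (j + 2) b₁ ≤ binTail (j + m) j a₁)
    (hweight : (j + 1) ^ 2 * (a₁ ^ j * (1 - a₁) ^ (m + 1))
      ≤ m ^ 2 * (b₁ ^ (j + 2) * (1 - b₁) ^ (m - 1)))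
    (hmode : (j + m + 1) * a₁ ≤ j)
    (hline : (j : ℝ) * (m - 1 - j) ≤ (j - (j + m + 1) * a₁) * (j + 1) * (j + m - 1))
    {α a b : ℝ} (hα : 0 < α) (hα₁ : α < binTail (j + m) (j + 2) b₁)
    (ha : a ∈ Set.Icc (0 : ℝ) 1) (hb : b ∈ Set.Icc (0 : ℝ) 1)
    (hta : binTail (j + m) j a = α) (htb : binTail (j + m) (j + 2) b = α) :
    0 < ∫ p in a..b, (binTail (j + m) (j + 1) p - α) := by
  have hpos := interior_weight_pos hj hm ha₁ hb₁ htail hweight hmode hline hα hα₁ ha hb hta htb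
  rw [integral_binTail_sub (by omega) (by omega)]
  have h1 := binTailPrimitive_right (k := j + 1) htb
  have h2 := binTailPrimitive_left (n := j + m) (k := j) (by omega) hta
  have hjR : (1 : ℝ) ≤ j := by exact_mod_cast hj
  have hmR : (2 : ℝ) ≤ m := by exact_mod_cast hm
  have hm1 : (0 : ℝ) < m - 1 := by linarith
  have e1 : j + m - j = m := by omega
  have e2 : j + m - (j + 1) = m - 1 := by omega
  have e3 : j + m - (j + 2) + 1 = m - 1 := by omega
  have hc2 : (((j + m).choose (j + 2) : ℕ) : ℝ) * ((j + 2 : ℕ) : ℝ)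
      = ((j + m).choose (j + 1) : ℝ) * ((j + m - (j + 1) : ℕ) : ℝ) := by
    exact_mod_cast Nat.choose_succ_right_eq (j + m) (j + 1)
  have e4 : ((m - 1 : ℕ) : ℝ) = m - 1 := by push_cast [Nat.cast_sub (by omega : 1 ≤ m)]; ring
  rw [e2, e4] at hc2
  push_cast at hc2
  have hA : (j + 1 : ℝ) / j * orderWeight (j + m) j a
      = (j + 1) * ((1 - a) * B (j + m) j a) := by
    simp only [orderWeight, B, e1]
    field_simp
    ring
  have hB : (m : ℝ) / (m - 1) * orderWeight (j + m) (j + 2) b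
      = m * (b * B (j + m) (j + 1) b) := by
    simp only [orderWeight, B, e2, e3]
    push_cast
    rw [mul_comm ((j : ℝ) + 2), hc2]
    field_simp
    ring
  rw [hA, hB] at hpos
  push_cast at h1 h2
  have hN : (0 : ℝ) < j + m + 1 := by positivity
  refine pos_of_mul_pos_right (a := (j : ℝ) + m + 1) ?_ hN.le
  have e5 : (j : ℝ) + m + 1 - (j + 1) = m := by ring
  rw [e5] at h1
  rw [mul_sub, h1, h2]
  linarith

theorem integral_single_pos {α : ℝ} (hα : α < 1 / 2) :
    0 < ∫ p in (0 : ℝ)..1, (binTail 1 1 p - α) := by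
  rw [integral_binTail_sub le_rfl le_rfl]
  simp [binTailPrimitive, orderWeight, binTail, B]
  linarith

theorem integral_first_pos {n : ℕ} (hn : 2 ≤ n) {b₁ : ℝ} (hb₁ : b₁ ∈ Set.Ioo (0 : ℝ) 1)
    (hweight : binTail n 2 b₁ ≤ n ^ 2 * (b₁ ^ 2 * (1 - b₁) ^ (n - 1)))
    {α b : ℝ} (hα : 0 < α) (hα₁ : α < binTail n 2 b₁)
    (hb : b ∈ Set.Icc (0 : ℝ) 1) (htb : binTail n 2 b = α) :
    0 < ∫ p in (0 : ℝ)..b, (binTail n 1 p - α) := by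
  have hnR : (2 : ℝ) ≤ n := by exact_mod_cast hn
  have hn1 : (0 : ℝ) < n - 1 := by linarith
  have hc : (n.choose 2 : ℝ) * 2 = n * (n - 1) := by
    rw [Nat.cast_choose_two]
    ring
  have hw : ∀ p, (n : ℝ) / (n - 1) * orderWeight n 2 p = n ^ 2 * (p ^ 2 * (1 - p) ^ (n - 1)) := by
    intro p
    have e : n - 2 + 1 = n - 1 := by omega
    simp only [orderWeight, e]
    push_cast
    rw [mul_comm (2 : ℝ), hc]
    field_simp
  have hmono := strictMonoOn_binTail (n := n) (k := 2) (by norm_num) hn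
  obtain ⟨q, q0, qc, qv, qd⟩ := exists_quantile (n := n) (k := 2) (by norm_num) hn
  have hb₁' := Set.Ioo_subset_Icc_self hb₁
  set w := binTail n 2 b₁ with hw'
  have hw1 : w < 1 := by
    rw [hw', ← binTail_at_one n 2 hn]
    exact hmono hb₁' (by simp) hb₁.2
  have hw0 : 0 < w := hα.trans hα₁
  have hsub : Set.Icc 0 w ⊆ Set.Icc 0 1 := Set.Icc_subset_Icc_right hw1.le
  have hsubo : Set.Ioo 0 w ⊆ Set.Ioo 0 1 := Set.Ioo_subset_Ioo_right hw1.le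
  have hqα : q α = b := by
    have hmem : α ∈ Set.Icc (0 : ℝ) 1 := ⟨hα.le, (hα₁.trans hw1).le⟩
    exact hmono.injOn (qv α hmem).1 hb ((qv α hmem).2.trans htb.symm)
  have hwmem : w ∈ Set.Icc (0 : ℝ) 1 := ⟨hw0.le, hw1.le⟩
  have hqw : q w = b₁ := hmono.injOn (qv w hwmem).1 hb₁' (qv w hwmem).2
  have key := pos_of_critical_points
    (E := fun u => (n : ℝ) / (n - 1) * orderWeight n 2 (q u) - u)
    (M := fun u => (n : ℝ) / (n - 1) * (2 - (n + 1) * q u) - 1) (w := w)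
    ?_ ?_ ?_ ?_ ?_ α ⟨hα, hα₁⟩
  · rw [integral_binTail_sub le_rfl (by omega)]
    have h1 := binTailPrimitive_right (n := n) (k := 1) htb
    have h2 : binTailPrimitive n 1 0 - α * 0 = 0 := by
      simp [binTailPrimitive, orderWeight, binTail_at_zero]
    rw [h2, sub_zero]
    simp only [hqα, hw] at key
    have e : b * B n 1 b = n * (b ^ 2 * (1 - b) ^ (n - 1)) := by
      simp only [B, Nat.choose_one_right]
      ring
    rw [e] at h1
    refine pos_of_mul_pos_right (a := (n : ℝ) + 1) ?_ (by positivity)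
    rw [h1]
    push_cast
    linarith
  · have h1 := (continuous_orderWeight n 2).comp_continuousOn (qc.mono hsub)
    exact (continuousOn_const.mul h1).sub continuousOn_id
  · simp [q0, orderWeight_at_zero]
  · simp only [hqw, hw]
    linarith
  · intro u hu
    have h1 := hasDerivAt_orderWeight_quantile (by norm_num) hn (qd u (hsubo hu)).1
      (qd u (hsubo hu)).2
    exact ((h1.const_mul ((n : ℝ) / (n - 1))).sub (hasDerivAt_id u)).congr_deriv (by push_cast; ring)
  · intro u hu _ _
    obtain ⟨hm, hd⟩ := qd u (hsubo hu)
    have hpos := orderDensity_pos (by norm_num) hn hm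
    refine ⟨(n : ℝ) / (n - 1) * (0 - (n + 1) * (orderDensity n 2 (q u))⁻¹), ?_, ?_⟩
    · have : 0 < (n : ℝ) / (n - 1) * ((n + 1) * (orderDensity n 2 (q u))⁻¹) := by positivity
      linarith
    · exact ((((hd.const_mul ((n : ℝ) + 1)).const_sub _).const_mul _).sub_const _).congr_deriv
        (by ring)

theorem pow_mul_sq_le {k : ℕ} (hk : 1 ≤ k) {a : ℝ} (ha : a ∈ Set.Icc (0 : ℝ) 1) :
    a ^ k * (1 - a) ^ 2 * (k + 2) ^ (k + 2) ≤ 4 * k ^ k := by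
  have hkR : (0 : ℝ) < k := by exact_mod_cast hk
  have h0 : 0 ≤ 1 - a := by linarith [ha.2]
  have h1 : a * (k + 2) / k ≤ Real.exp (a * (k + 2) / k - 1) := by
    linarith [Real.add_one_le_exp (a * (k + 2) / k - 1)]
  have h2 : (1 - a) * (k + 2) / 2 ≤ Real.exp ((1 - a) * (k + 2) / 2 - 1) := by
    linarith [Real.add_one_le_exp ((1 - a) * (k + 2) / 2 - 1)]
  have h3 : (a * (k + 2) / k) ^ k * ((1 - a) * (k + 2) / 2) ^ 2 ≤ 1 := by
    calc _ ≤ Real.exp (a * (k + 2) / k - 1) ^ k * Real.exp ((1 - a) * (k + 2) / 2 - 1) ^ 2 := by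
          have := ha.1
          gcongr
      _ = 1 := by
          rw [← Real.exp_nat_mul, ← Real.exp_nat_mul, ← Real.exp_add, Real.exp_eq_one_iff]
          push_cast
          field_simp
          ring
  have h4 : (a * (k + 2) / k) ^ k * ((1 - a) * (k + 2) / 2) ^ 2
      = a ^ k * (1 - a) ^ 2 * (k + 2) ^ (k + 2) / (4 * k ^ k) := by
    rw [div_pow, div_pow, mul_pow, mul_pow, pow_add]
    field_simp
    ring
  rw [h4, div_le_one (by positivity)] at h3
  exact h3

theorem integral_last_pos {k : ℕ} {α a : ℝ} (hk : 1 ≤ k)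
    (hcert : 4 * ((k + 1) ^ 2 * (k : ℝ) ^ k) < (1 - α) * (k + 2) ^ (k + 2))
    (ha : a ∈ Set.Icc (0 : ℝ) 1) (hta : binTail (k + 1) k a = α) :
    0 < ∫ p in a..1, (binTail (k + 1) (k + 1) p - α) := by
  rw [integral_binTail_sub (by omega) le_rfl]
  have h2 := binTailPrimitive_left (n := k + 1) (k := k) le_rfl hta
  have h1 : binTailPrimitive (k + 1) (k + 1) 1 = 1 / ((k : ℝ) + 2) := by
    simp only [binTailPrimitive, binTail_at_one (k + 1) (k + 1) le_rfl]
    simp [orderWeight]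
    field_simp
    ring
  have e : k + 1 - k = 1 := by omega
  have h3 : (1 - a) * B (k + 1) k a = (k + 1) * (a ^ k * (1 - a) ^ 2) := by
    simp only [B, e, Nat.choose_succ_self_right]
    push_cast
    ring
  have h4 := pow_mul_sq_le hk ha
  have hP : (0 : ℝ) < (k + 2) ^ (k + 2) := by positivity
  have h5 : ((k : ℝ) + 1) ^ 2 * (a ^ k * (1 - a) ^ 2) < 1 - α := by
    refine lt_of_mul_lt_mul_right (a := ((k : ℝ) + 2) ^ (k + 2)) ?_ hP.le
    have := mul_le_mul_of_nonneg_left h4 (by positivity : (0 : ℝ) ≤ ((k : ℝ) + 1) ^ 2)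
    linarith
  rw [h3] at h2
  push_cast at h2
  refine pos_of_mul_pos_right (a := (k : ℝ) + 2) ?_ (by positivity)
  have h6 : ((k : ℝ) + 2) * (1 / (k + 2)) = 1 := by field_simp
  rw [h1, mul_sub, mul_sub ((k : ℝ) + 2) (1 / _), h6]
  linarith

/-- The primitive of `binTail n k - α` whose equal values characterise the endpoints. -/
noncomputable def excess (n : ℕ) (α : ℝ) (k : ℕ) (p : ℝ) : ℝ := binTailPrimitive n k p - α * p

theorem hasDerivAt_excess {n k : ℕ} (hk : 1 ≤ k) (hkn : k ≤ n) (α p : ℝ) :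
    HasDerivAt (excess n α k) (binTail n k p - α) p :=
  ((hasDerivAt_binTailPrimitive hk hkn p).sub ((hasDerivAt_id p).const_mul α)).congr_deriv
    (by simp)

theorem continuous_excess {n k : ℕ} (hk : 1 ≤ k) (hkn : k ≤ n) (α : ℝ) :
    Continuous (excess n α k) :=
  continuous_iff_continuousAt.2 fun p => (hasDerivAt_excess hk hkn α p).continuousAt

theorem strictAntiOn_excess {n k : ℕ} (hk : 1 ≤ k) (hkn : k ≤ n) {α c : ℝ}
    (hc : c ∈ Set.Icc (0 : ℝ) 1) (hcα : binTail n k c = α) :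
    StrictAntiOn (excess n α k) (Set.Icc 0 c) := by
  refine strictAntiOn_of_deriv_neg (convex_Icc 0 c) (continuous_excess hk hkn α).continuousOn ?_
  intro p hp
  rw [interior_Icc] at hp
  rw [(hasDerivAt_excess hk hkn α p).deriv]
  have := strictMonoOn_binTail hk hkn ⟨hp.1.le, hp.2.le.trans hc.2⟩ hc hp.2
  linarith

theorem strictMonoOn_excess {n k : ℕ} (hk : 1 ≤ k) (hkn : k ≤ n) {α c : ℝ}
    (hc : c ∈ Set.Icc (0 : ℝ) 1) (hcα : binTail n k c = α) :
    StrictMonoOn (excess n α k) (Set.Icc c 1) := by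
  refine strictMonoOn_of_deriv_pos (convex_Icc c 1) (continuous_excess hk hkn α).continuousOn ?_
  intro p hp
  rw [interior_Icc] at hp
  rw [(hasDerivAt_excess hk hkn α p).deriv]
  have := strictMonoOn_binTail hk hkn hc ⟨hc.1.trans hp.1.le, hp.2.le⟩ hp.1
  linarith

theorem integral_eq_iff_excess_eq {n i : ℕ} (hi : i + 1 ≤ n) (α a b : ℝ) :
    (∫ p in a..b, ∑ x ∈ Finset.range (i + 1), B n x p) = (1 - α) * (b - a)
      ↔ excess n α (i + 1) b = excess n α (i + 1) a := by
  have h1 := integral_binTail_sub (k := i + 1) (by omega) hi α a b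
  have hc : Continuous fun p => ∑ x ∈ Finset.range (i + 1), B n x p := by
    unfold B
    fun_prop
  have h2 : ∫ p in a..b, (binTail n (i + 1) p - α)
      = (1 - α) * (b - a) - ∫ p in a..b, ∑ x ∈ Finset.range (i + 1), B n x p := by
    have e : (fun p => binTail n (i + 1) p - α)
        = fun p => (1 - α) - ∑ x ∈ Finset.range (i + 1), B n x p := by
      funext p
      simp only [binTail]
      ring
    rw [e, intervalIntegral.integral_sub intervalIntegrable_const (hc.intervalIntegrable a b),
      intervalIntegral.integral_const, smul_eq_mul, mul_comm]
  rw [h2] at h1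
  unfold excess
  constructor <;> intro h <;> linarith

/-- Existence and uniqueness of the next endpoint from the positivity of the integrals between
quantiles `Q (k - 1)` and `Q (k + 1)`. -/
theorem existsUnique_next_endpoint {n : ℕ} {α : ℝ} {Q : ℕ → ℝ} (hQ0 : Q 0 = 0) (hQn : Q (n + 1) = 1)
    (hQ : ∀ k, 1 ≤ k → k ≤ n → Q k ∈ Set.Ioo (0 : ℝ) 1 ∧ binTail n k (Q k) = α)
    (hpos : ∀ k, k + 1 ≤ n → 0 < ∫ p in (Q k)..(Q (k + 2)), (binTail n (k + 1) p - α))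
    {j : ℕ} (hj : j + 1 ≤ n) {l : ℕ → ℝ} (hl0 : l 0 = 0)
    (hmono : ∀ i, i < j → l i < l (i + 1)) (hlj : l j < 1)
    (heq : ∀ i, i < j →
      (∫ p in (l i)..(l (i + 1)), ∑ x ∈ Finset.range (i + 1), B n x p)
        = (1 - α) * (l (i + 1) - l i)) :
    ∃! b : ℝ, l j < b ∧ b < 1 ∧
      (∫ p in (l j)..b, ∑ x ∈ Finset.range (j + 1), B n x p) = (1 - α) * (b - l j) := by
  have hQmem : ∀ k, k ≤ n + 1 → Q k ∈ Set.Icc (0 : ℝ) 1 := by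
    intro k hk
    rcases Nat.eq_zero_or_pos k with rfl | hk0
    · simp [hQ0]
    rcases hk.eq_or_lt with rfl | hk1
    · simp [hQn]
    exact Set.Ioo_subset_Icc_self (hQ k hk0 (by omega)).1
  have hQlt : ∀ k, k ≤ n → Q k < Q (k + 1) := by
    intro k hk
    rcases Nat.eq_zero_or_pos k with rfl | hk0
    · rcases hk.eq_or_lt with rfl | hk1
      · rw [hQ0, hQn]
        exact zero_lt_one
      · rw [hQ0]
        exact (hQ 1 le_rfl hk1).1.1
    rcases hk.eq_or_lt with rfl | hk1
    · rw [hQn]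
      exact (hQ k hk0 le_rfl).1.2
    refine ((strictMonoOn_binTail hk0 hk).lt_iff_lt (hQmem k (by omega))
      (hQmem (k + 1) (by omega))).1 ?_
    obtain ⟨hm, hv⟩ := hQ (k + 1) (by omega) hk1
    rw [(hQ k hk0 hk).2, binTail_succ, hv]
    have hc : (0 : ℝ) < n.choose k := by exact_mod_cast Nat.choose_pos hk
    have h1 := hm.1
    have h2 : 0 < 1 - Q (k + 1) := sub_pos.2 hm.2
    have : 0 < B n k (Q (k + 1)) := by
      unfold B
      positivity
    linarith
  have hexc : ∀ k, k + 1 ≤ n → excess n α (k + 1) (Q k) < excess n α (k + 1) (Q (k + 2)) := by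
    intro k hk
    have := hpos k hk
    rw [integral_binTail_sub (by omega) hk] at this
    unfold excess
    linarith
  have hle : ∀ i, i ≤ j → l i ≤ l j := by
    intro i hi
    refine Nat.decreasingInduction' (P := fun i => l i ≤ l j) (fun k hk _ ih => ?_) hi le_rfl
    exact (hmono k hk).le.trans ih
  have hanti : ∀ k, k + 1 ≤ n → StrictAntiOn (excess n α (k + 1)) (Set.Icc 0 (Q (k + 1))) :=
    fun k hk => strictAntiOn_excess (by omega) hk (hQmem _ (by omega)) (hQ _ (by omega) hk).2
  have hincr : ∀ k, k + 1 ≤ n → StrictMonoOn (excess n α (k + 1)) (Set.Icc (Q (k + 1)) 1) :=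
    fun k hk => strictMonoOn_excess (by omega) hk (hQmem _ (by omega)) (hQ _ (by omega) hk).2
  have hloc : ∀ i, i ≤ j → Q i ≤ l i ∧ l i < Q (i + 1) := by
    intro i
    induction i with
    | zero =>
      intro _
      rw [hl0, hQ0]
      exact ⟨le_rfl, hQ0 ▸ hQlt 0 (by omega)⟩
    | succ i ih =>
      intro hi
      obtain ⟨h1, h2⟩ := ih (by omega)
      have hin : i + 1 ≤ n := by omega
      have hE := (integral_eq_iff_excess_eq hin α _ _).1 (heq i (by omega))
      have hl := hmono i (by omega)
      have hlnn : 0 ≤ l i := (hQmem i (by omega)).1.trans h1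
      have hl1 : l (i + 1) < 1 := (hle _ hi).trans_lt hlj
      have hgt : Q (i + 1) < l (i + 1) := by
        by_contra! h
        exact (hanti i hin ⟨hlnn, h2.le⟩ ⟨hlnn.trans hl.le, h⟩ hl).ne hE
      refine ⟨hgt.le, ?_⟩
      by_contra! h
      have h3 := (hincr i hin).monotoneOn
        ⟨(hQlt (i + 1) hin).le, (hQmem (i + 2) (by omega)).2⟩ ⟨hgt.le, hl1.le⟩ h
      have h4 := (hanti i hin).antitoneOn ⟨(hQmem i (by omega)).1, (hQlt i (by omega)).le⟩
        ⟨hlnn, h2.le⟩ h1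
      have h5 := hexc i hin
      linarith
  obtain ⟨h1, h2⟩ := hloc j le_rfl
  have hlnn : 0 ≤ l j := (hQmem j (by omega)).1.trans h1
  have hQj := hQmem (j + 1) (by omega)
  have hlow := hanti j hj ⟨hlnn, h2.le⟩ ⟨hQj.1, le_rfl⟩ h2
  have hhigh : excess n α (j + 1) (l j) < excess n α (j + 1) 1 := by
    have h3 := (hincr j hj).monotoneOn
      ⟨(hQlt (j + 1) hj).le, (hQmem (j + 2) (by omega)).2⟩ ⟨hQj.2, le_rfl⟩
      (hQmem (j + 2) (by omega)).2
    have h4 := (hanti j hj).antitoneOn ⟨(hQmem j (by omega)).1, (hQlt j (by omega)).le⟩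
      ⟨hlnn, h2.le⟩ h1
    exact (h4.trans_lt (hexc j hj)).trans_le h3
  obtain ⟨b, hb, hbE⟩ := intermediate_value_Ioo hQj.2
    (continuous_excess (by omega) hj α).continuousOn ⟨hlow, hhigh⟩
  refine ⟨b, ⟨h2.trans hb.1, hb.2, (integral_eq_iff_excess_eq hj α _ _).2 hbE⟩, ?_⟩
  rintro c ⟨hc1, hc2, hc3⟩
  rw [integral_eq_iff_excess_eq hj] at hc3
  have hgt : Q (j + 1) < c := by
    by_contra! h
    exact (hanti j hj ⟨hlnn, h2.le⟩ ⟨hlnn.trans hc1.le, h⟩ hc1).ne hc3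
  exact (hincr j hj).injOn ⟨hgt.le, hc2.le⟩ ⟨hb.1.le, hb.2.le⟩ (hc3.trans hbE.symm)

/-- `f x`, arranged so that kernel reduction evaluates the numeral `x` before substituting it. -/
def forced {β : Type} (x : ℕ) (f : ℕ → β) : β := Nat.rec (f 0) (fun t _ => f (Nat.succ t)) x

theorem forced_eq {β : Type} (x : ℕ) (f : ℕ → β) : forced x f = f x := by
  cases x <;> rfl

/-- `Q ^ n` times `P(Bin(n, A / Q) < k)`, where `Q = A + D`. -/
def natCdf (n k A D : ℕ) : ℕ := ∑ x ∈ Finset.range k, n.choose x * A ^ x * D ^ (n - x)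

/-- A lower approximation, with scale `S`, of the last `i` terms of `natCdf n k A D` divided by the
smallest-index one among them. -/
def floorSum (n k A D S i : ℕ) : ℕ :=
  Nat.rec 0 (fun i r => Nat.add S (Nat.div (Nat.mul (Nat.mul (Nat.add (Nat.sub n k) (Nat.succ i)) A)
    r) (Nat.mul (Nat.sub k i) D))) i

theorem floorSum_succ (n k A D S i : ℕ) : floorSum n k A D S (i + 1)
    = S + (n - k + (i + 1)) * A * floorSum n k A D S i / ((k - i) * D) := rfl

theorem binomial_term_ratio {n x : ℕ} (hx : x < n) (A D : ℕ) :
    n.choose x * A ^ x * D ^ (n - x) * ((n - x) * A)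
      = n.choose (x + 1) * A ^ (x + 1) * D ^ (n - (x + 1)) * ((x + 1) * D) := by
  have h := Nat.choose_succ_right_eq n x
  have e : n - x = n - (x + 1) + 1 := by omega
  have e2 : D ^ (n - x) = D ^ (n - (x + 1)) * D := by rw [e, pow_succ]
  rw [e2, pow_succ]
  calc _ = n.choose x * (n - x) * (A ^ x * A * (D ^ (n - (x + 1)) * D)) := by ring
    _ = _ := by rw [← h]; ring

theorem floorSum_mul_le {n k A D S : ℕ} (hk : k ≤ n) (hD : 0 < D) (i : ℕ) (hi : i ≤ k) :
    floorSum n k A D S i * (n.choose (k - i) * A ^ (k - i) * D ^ (n - (k - i)))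
      ≤ S * ∑ x ∈ Finset.Ico (k - i) k, n.choose x * A ^ x * D ^ (n - x) := by
  induction i with
  | zero => simp [floorSum]
  | succ i ih =>
    obtain ⟨x, rfl⟩ := Nat.exists_eq_add_of_le hi
    have ih := ih (by omega)
    have e1 : i + 1 + x - i = x + 1 := by omega
    have e2 : i + 1 + x - (i + 1) = x := by omega
    have e3 : n - (i + 1 + x) + (i + 1) = n - x := by omega
    rw [e1] at ih
    rw [floorSum_succ, e1, e2, e3, Finset.sum_eq_sum_Ico_succ_bot (by omega), mul_add, add_mul]
    refine Nat.add_le_add_left (le_trans ?_ ih) _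
    refine Nat.le_of_mul_le_mul_right (c := (x + 1) * D) ?_ (by positivity)
    have hdiv := Nat.div_mul_le_self ((n - x) * A * floorSum n (i + 1 + x) A D S i) ((x + 1) * D)
    have hr := binomial_term_ratio (by omega : x < n) A D
    calc _ = (n - x) * A * floorSum n (i + 1 + x) A D S i / ((x + 1) * D) * ((x + 1) * D)
          * (n.choose x * A ^ x * D ^ (n - x)) := by ring
      _ ≤ (n - x) * A * floorSum n (i + 1 + x) A D S i
          * (n.choose x * A ^ x * D ^ (n - x)) := Nat.mul_le_mul_right _ hdiv
      _ = floorSum n (i + 1 + x) A D S i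
          * (n.choose x * A ^ x * D ^ (n - x) * ((n - x) * A)) := by ring
      _ = _ := by rw [hr]; ring

theorem le_floorSum_mul {n k A D S : ℕ} (hk : k ≤ n) (hD : 0 < D) (i : ℕ) (hi : i ≤ k) :
    S ^ i * (S * ∑ x ∈ Finset.Ico (k - i) k, n.choose x * A ^ x * D ^ (n - x))
      ≤ (S + 2) ^ i * (floorSum n k A D S i
        * (n.choose (k - i) * A ^ (k - i) * D ^ (n - (k - i)))) := by
  induction i with
  | zero => simp [floorSum]
  | succ i ih =>
    obtain ⟨x, rfl⟩ := Nat.exists_eq_add_of_le hi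
    have ih := ih (by omega)
    have e1 : i + 1 + x - i = x + 1 := by omega
    have e2 : i + 1 + x - (i + 1) = x := by omega
    have e3 : n - (i + 1 + x) + (i + 1) = n - x := by omega
    rw [e1] at ih
    rw [floorSum_succ, e1, e2, e3, Finset.sum_eq_sum_Ico_succ_bot (by omega)]
    set r := floorSum n (i + 1 + x) A D S i
    set y := (n - x) * A * r / ((x + 1) * D) with hy
    set t := n.choose x * A ^ x * D ^ (n - x) with ht
    set t' := n.choose (x + 1) * A ^ (x + 1) * D ^ (n - (x + 1))
    have hstep : r * t' ≤ (y + 1) * t := by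
      refine Nat.le_of_mul_le_mul_right (c := (x + 1) * D) ?_ (by positivity)
      have hdiv := (Nat.lt_mul_of_div_lt (Nat.lt_succ_self y) (by positivity)).le
      have hr := binomial_term_ratio (by omega : x < n) A D
      calc r * t' * ((x + 1) * D) = r * (t' * ((x + 1) * D)) := by ring
        _ = (n - x) * A * r * t := by rw [← hr]; ring
        _ ≤ (y + 1) * ((x + 1) * D) * t := Nat.mul_le_mul_right _ hdiv
        _ = _ := by ring
    have hpow : S ^ i ≤ (S + 2) ^ i := Nat.pow_le_pow_left (by omega) i
    calc _ = S ^ i * (S * S * t)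
          + S * (S ^ i * (S * ∑ x ∈ Finset.Ico (x + 1) (i + 1 + x),
            n.choose x * A ^ x * D ^ (n - x))) := by ring
      _ ≤ (S + 2) ^ i * (S * S * t) + S * ((S + 2) ^ i * ((y + 1) * t)) :=
        Nat.add_le_add (Nat.mul_le_mul_right _ hpow)
          (Nat.mul_le_mul_left _ (ih.trans (Nat.mul_le_mul_left _ hstep)))
      _ ≤ (S + 2) ^ i * (S * S * t) + S * ((S + 2) ^ i * ((y + 1) * t))
          + (S + 2) ^ i * ((S + 2 * y) * t) := Nat.le_add_right _ _
      _ = _ := by ring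

theorem floorSum_le_natCdf {n k A D S : ℕ} (hk : k ≤ n) (hD : 0 < D) :
    floorSum n k A D S k * D ^ n ≤ S * natCdf n k A D := by
  simpa [natCdf] using floorSum_mul_le (A := A) (S := S) hk hD k le_rfl

theorem natCdf_le_floorSum {n k A D S : ℕ} (hk : k ≤ n) (hD : 0 < D) :
    S ^ k * (S * natCdf n k A D) ≤ (S + 2) ^ k * (floorSum n k A D S k * D ^ n) := by
  simpa [natCdf] using le_floorSum_mul (A := A) (S := S) hk hD k le_rfl

theorem natCdf_add_reflect {n k : ℕ} (hk : k ≤ n) (A D : ℕ) :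
    natCdf n k A D + natCdf n (n + 1 - k) D A = (A + D) ^ n := by
  rw [add_pow, ← Finset.sum_range_add_sum_Ico _ (by omega : k ≤ n + 1)]
  unfold natCdf
  congr 1
  · exact Finset.sum_congr rfl fun x _ => by rw [Nat.cast_id]; ring
  · simp only [Nat.cast_id]
    have h := Finset.sum_Ico_reflect (fun x => A ^ x * D ^ (n - x) * n.choose x) 0
      (m := n + 1 - k) (n := n) (by omega)
    rw [(by omega : n + 1 - (n + 1 - k) = k), Nat.sub_zero] at h
    rw [← h, Finset.range_eq_Ico]
    refine Finset.sum_congr rfl fun x hx => ?_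
    have hx' : x ≤ n := by have := (Finset.mem_Ico.1 hx).2; omega
    simp only [Nat.choose_symm hx', Nat.sub_sub_self hx']
    ring

theorem binTail_div {n k A D : ℕ} (hk : k ≤ n + 1) (hQ : 0 < A + D) :
    binTail n k (A / (A + D : ℕ)) = 1 - natCdf n k A D / ((A + D : ℕ) : ℝ) ^ n := by
  have hQ' : (0 : ℝ) < (A : ℝ) + D := by exact_mod_cast hQ
  have e : 1 - (A : ℝ) / (A + D) = D / (A + D) := by
    field_simp
    ring
  simp only [binTail, natCdf]
  push_cast
  rw [Finset.sum_div]
  congr 1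
  refine Finset.sum_congr rfl fun x hx => ?_
  have hx' : x ≤ n := by have := Finset.mem_range.1 hx; omega
  rw [B, e, div_pow, div_pow, ← Nat.add_sub_cancel' hx', pow_add, Nat.add_sub_cancel_left]
  field_simp

/-- The comparison of tail probabilities at `A / Q` and `A' / Q`, with sums over small indices. -/
def lowerTailCheck (n j Q A D A' D' S : ℕ) : Bool :=
  forced (j + 2) fun k => forced (Nat.mul (floorSum n k A' D' S k) (Nat.pow D' n)) fun r =>
  Nat.ble (Nat.mul (Nat.pow (S + 2) j) (Nat.mul (floorSum n j A D S j) (Nat.pow D n)))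
    (Nat.mul (Nat.pow S j) r) &&
  Nat.ble (Nat.mul (Nat.pow (S + 2) k) (Nat.mul 100 r))
    (Nat.mul (Nat.mul 73 (Nat.pow S (k + 1))) (Nat.pow Q n))

/-- The comparison of tail probabilities at `A / Q` and `A' / Q`, with sums over large indices. -/
def upperTailCheck (n j Q A D A' D' S : ℕ) : Bool :=
  forced (n - j + 1) fun k => forced (n - j - 1) fun k' =>
  forced (Nat.mul (floorSum n k' D' A' S k') (Nat.pow A' n)) fun r =>
  Nat.ble (Nat.mul (Nat.pow (S + 2) k') r)
    (Nat.mul (Nat.pow S k') (Nat.mul (floorSum n k D A S k) (Nat.pow A n))) &&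
  Nat.ble (Nat.mul (Nat.mul 27 S) (Nat.pow Q n)) (Nat.mul 100 r)

/-- The remaining conditions on the pair `A / Q`, `A' / Q`. -/
def endpointCheck (n j Q A D A' D' : ℕ) : Bool :=
  Nat.ble 1 A && Nat.ble 1 D && Nat.ble 1 A' && Nat.ble 1 D' &&
  Nat.ble (A + D) Q && Nat.ble Q (A + D) && Nat.ble (A' + D') Q && Nat.ble Q (A' + D') &&
  Nat.ble ((n + 1) * A) (j * Q) &&
  Nat.ble (j * (n - j - 1 - j) * Q) ((j * Q - (n + 1) * A) * (j + 1) * (n - 1)) &&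
  Nat.ble ((j + 1) ^ 2 * (A ^ j * D ^ (n - j + 1)))
    ((n - j) ^ 2 * (A' ^ (j + 2) * D' ^ (n - j - 1)))

/-- The odd multiple of `2 ^ (-24)` near `x / y`, scaled by `2 ^ 24`. -/
def oddRound (x y : ℕ) : ℕ := 2 * (2 ^ 23 * x / y) + 1

def lowerCheck (n j : ℕ) : Bool :=
  forced (2 ^ 24) fun Q => forced (2 ^ 64 + 1) fun S =>
  forced (oddRound (j * (5 * j - 1)) (5 * (j + 1) * (n + 1))) fun A =>
  forced (oddRound ((5 * (n - j) * (j + 2) - 6 * (n - j - 1)) * (33 * j + 20) + 50 * (n - j))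
    (5 * (n - j) * (33 * j + 20) * (n + 1))) fun A' =>
  forced (Nat.sub Q A) fun D => forced (Nat.sub Q A') fun D' =>
  endpointCheck n j Q A D A' D' && lowerTailCheck n j Q A D A' D' S

def upperCheck (n j : ℕ) : Bool :=
  forced (2 ^ 24) fun Q => forced (2 ^ 64 + 1) fun S =>
  forced (oddRound (5 * j - 2) (5 * (n + 1))) fun A =>
  forced (oddRound (5 * j * (n - j) * (j + 2) - 2 * (j + 1) * (n - j - 1))
    (5 * j * (n - j) * (n + 1))) fun A' =>
  forced (Nat.sub Q A) fun D => forced (Nat.sub Q A') fun D' =>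
  endpointCheck n j Q A D A' D' && upperTailCheck n j Q A D A' D' S

def interiorCheck (n j : ℕ) : Bool :=
  bif Nat.ble (n - j) (j + 1) then upperCheck n j else lowerCheck n j

def allBelow (f : ℕ → Bool) (n : ℕ) : Bool := Nat.rec true (fun n r => f n && r) n

theorem allBelow_spec {f : ℕ → Bool} {n : ℕ} (h : allBelow f n = true) : ∀ i < n, f i = true := by
  induction n with
  | zero => intro i hi; omega
  | succ n ih =>
    have h' : (f n && allBelow f n) = true := h
    rw [Bool.and_eq_true] at h'
    intro i hi
    rcases Nat.lt_succ_iff_lt_or_eq.1 hi with hi | rfl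
    · exact ih h'.2 i hi
    · exact h'.1

def rowCheck (n : ℕ) : Bool :=
  forced n fun n => allBelow (fun i => forced (i + 1) fun j => interiorCheck n j) (n - 2)

def firstCheck (n : ℕ) : Bool :=
  Nat.ble (100 * ((5 * n - 7) ^ n + 7 * n * (5 * n - 7) ^ (n - 1))) (73 * (5 * n) ^ n) &&
  Nat.ble (5 * n * (5 * n) ^ n) (5 * n * ((5 * n - 7) ^ n + 7 * n * (5 * n - 7) ^ (n - 1))
    + 49 * n ^ 2 * (5 * n - 7) ^ (n - 1))

def lastCheck (k : ℕ) : Bool :=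
  Nat.ble (400 * ((k + 1) ^ 2 * k ^ k)) (73 * (k + 2) ^ (k + 2))

theorem rowCheck_below_100 : allBelow rowCheck 100 = true := by decide +kernel

theorem rowCheck_below_135 : allBelow (fun t => rowCheck (t + 100)) 35 = true := by decide +kernel

theorem rowCheck_below_160 : allBelow (fun t => rowCheck (t + 135)) 25 = true := by decide +kernel

theorem rowCheck_below_175 : allBelow (fun t => rowCheck (t + 160)) 15 = true := by decide +kernel

theorem rowCheck_below_188 : allBelow (fun t => rowCheck (t + 175)) 13 = true := by decide +kernel

theorem rowCheck_below_201 : allBelow (fun t => rowCheck (t + 188)) 13 = true := by decide +kernel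

theorem firstCheck_below_199 : allBelow (fun t => firstCheck (t + 2)) 199 = true := by
  decide +kernel

theorem lastCheck_below_200 : allBelow (fun t => lastCheck (t + 1)) 199 = true := by decide +kernel

/-- The endpoint conditions that make the integral between two quantiles positive. -/
def HasEndpoints (j m : ℕ) : Prop :=
  ∃ a₁ b₁ : ℝ, a₁ ∈ Set.Ioo (0 : ℝ) 1 ∧ b₁ ∈ Set.Ioo (0 : ℝ) 1 ∧
    binTail (j + m) (j + 2) b₁ ≤ binTail (j + m) j a₁ ∧
    (j + 1) ^ 2 * (a₁ ^ j * (1 - a₁) ^ (m + 1)) ≤ m ^ 2 * (b₁ ^ (j + 2) * (1 - b₁) ^ (m - 1)) ∧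
    (j + m + 1) * a₁ ≤ j ∧
    (j : ℝ) * (m - 1 - j) ≤ (j - (j + m + 1) * a₁) * (j + 1) * (j + m - 1) ∧
    27 / 100 ≤ binTail (j + m) (j + 2) b₁

theorem pow_mul_pow_div (A D k l N : ℕ) (hN : k + l = N) (hQ : 0 < A + D) :
    ((A : ℝ) / (A + D : ℕ)) ^ k * (1 - (A : ℝ) / (A + D : ℕ)) ^ l
      = (A ^ k * D ^ l : ℕ) / ((A + D : ℕ) : ℝ) ^ N := by
  have hQ' : (0 : ℝ) < (A : ℝ) + D := by exact_mod_cast hQ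
  have e : 1 - (A : ℝ) / (A + D) = D / (A + D) := by
    field_simp
    ring
  push_cast
  rw [e, div_pow, div_pow, ← hN, pow_add]
  field_simp

theorem hasEndpoints_of_endpointCheck {j m Q A D A' D' : ℕ} (hj : 1 ≤ j) (hm : 2 ≤ m)
    (h : endpointCheck (j + m) j Q A D A' D' = true)
    (htail : natCdf (j + m) j A D ≤ natCdf (j + m) (j + 2) A' D')
    (hlevel : 100 * natCdf (j + m) (j + 2) A' D' ≤ 73 * Q ^ (j + m)) : HasEndpoints j m := by
  simp only [endpointCheck, Bool.and_eq_true, Nat.ble_eq, Nat.add_sub_cancel_left] at h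
  obtain ⟨⟨⟨⟨⟨⟨⟨⟨⟨⟨hA, hD⟩, hA'⟩, hD'⟩, hQ1⟩, hQ2⟩, hQ1'⟩, hQ2'⟩, hmode⟩, hline⟩, hweight⟩ := h
  obtain rfl : Q = A + D := le_antisymm hQ2 hQ1
  have hQ' : A + D = A' + D' := le_antisymm hQ2' hQ1'
  have hQpos : (0 : ℝ) < ((A + D : ℕ) : ℝ) := by exact_mod_cast (by omega : 0 < A + D)
  have hmem : ∀ {x y : ℕ}, 1 ≤ x → 1 ≤ y → (x : ℝ) / (x + y : ℕ) ∈ Set.Ioo (0 : ℝ) 1 := by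
    intro x y hx hy
    have hx' : (0 : ℝ) < x := by exact_mod_cast hx
    have hy' : (0 : ℝ) < y := by exact_mod_cast hy
    push_cast
    exact ⟨by positivity, by rw [div_lt_one (by positivity)]; linarith⟩
  have hmode' : ((j : ℝ) + m + 1) * (A / (A + D : ℕ)) ≤ j := by
    rw [← mul_div_assoc, div_le_iff₀ hQpos]
    exact_mod_cast hmode
  refine ⟨A / (A + D : ℕ), A' / (A' + D' : ℕ), hmem hA hD, hmem hA' hD', ?_, ?_, hmode', ?_, ?_⟩
  · rw [binTail_div (by omega) (by omega), binTail_div (by omega) (by omega), ← hQ']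
    have : (natCdf (j + m) j A D : ℝ) ≤ natCdf (j + m) (j + 2) A' D' := by exact_mod_cast htail
    gcongr
  · rw [pow_mul_pow_div A D j (m + 1) (j + m + 1) (by omega) (by omega),
      pow_mul_pow_div A' D' (j + 2) (m - 1) (j + m + 1) (by omega) (by omega), ← hQ',
      ← mul_div_assoc, ← mul_div_assoc]
    refine div_le_div_of_nonneg_right ?_ (by positivity)
    exact_mod_cast hweight
  · have e1 : (j : ℝ) - (j + m + 1) * (A / (A + D : ℕ))
        = ((j * (A + D) - (j + m + 1) * A : ℕ) : ℝ) / (A + D : ℕ) := by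
      rw [Nat.cast_sub hmode]
      push_cast at hQpos ⊢
      field_simp
    have e2 : (j : ℝ) * (m - 1 - j) ≤ ((j * (m - 1 - j) : ℕ) : ℝ) := by
      rw [Nat.cast_mul]
      refine mul_le_mul_of_nonneg_left ?_ (Nat.cast_nonneg j)
      have : (m : ℝ) ≤ ((m - 1 - j : ℕ) : ℝ) + 1 + j := by
        exact_mod_cast (by omega : m ≤ (m - 1 - j) + 1 + j)
      linarith
    have e3 : (j : ℝ) + m - 1 = ((j + m - 1 : ℕ) : ℝ) := by
      rw [Nat.cast_sub (by omega)]
      push_cast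
      ring
    refine e2.trans ?_
    rw [e1, e3, div_mul_eq_mul_div, div_mul_eq_mul_div, le_div_iff₀ hQpos]
    exact_mod_cast hline
  · rw [binTail_div (by omega) (by omega), ← hQ', le_sub_comm, div_le_iff₀ (by positivity)]
    have : (100 : ℝ) * natCdf (j + m) (j + 2) A' D' ≤ 73 * ((A + D : ℕ) : ℝ) ^ (j + m) := by
      exact_mod_cast hlevel
    linarith

theorem natCdf_le_of_lowerTailCheck {j m Q A D A' D' S : ℕ} (hm : 2 ≤ m) (hS : 0 < S) (hD : 0 < D)
    (hD' : 0 < D') (h : lowerTailCheck (j + m) j Q A D A' D' S = true) :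
    natCdf (j + m) j A D ≤ natCdf (j + m) (j + 2) A' D' ∧
      100 * natCdf (j + m) (j + 2) A' D' ≤ 73 * Q ^ (j + m) := by
  simp only [lowerTailCheck, forced_eq, Bool.and_eq_true, Nat.ble_eq, Nat.mul_eq, Nat.pow_eq] at h
  obtain ⟨h1, h2⟩ := h
  have hA := natCdf_le_floorSum (n := j + m) (k := j) (A := A) (S := S) (by omega) hD
  have hB := floorSum_le_natCdf (n := j + m) (k := j + 2) (A := A') (S := S) (by omega) hD'
  have hB' := natCdf_le_floorSum (n := j + m) (k := j + 2) (A := A') (S := S) (by omega) hD'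
  constructor
  · refine Nat.le_of_mul_le_mul_left (c := S ^ j * S) ?_ (by positivity)
    calc S ^ j * S * natCdf (j + m) j A D = S ^ j * (S * natCdf (j + m) j A D) := by ring
      _ ≤ _ := hA
      _ ≤ _ := h1
      _ ≤ _ := Nat.mul_le_mul_left _ hB
      _ = _ := by ring
  · refine Nat.le_of_mul_le_mul_left (c := S ^ (j + 2 + 1)) ?_ (by positivity)
    calc _ = 100 * (S ^ (j + 2) * (S * natCdf (j + m) (j + 2) A' D')) := by ring
      _ ≤ _ := Nat.mul_le_mul_left _ hB'
      _ = (S + 2) ^ (j + 2)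
          * (100 * (floorSum (j + m) (j + 2) A' D' S (j + 2) * D' ^ (j + m))) := by ring
      _ ≤ _ := h2
      _ = _ := by ring

theorem natCdf_le_of_upperTailCheck {j m Q A D A' D' S : ℕ} (hj : 1 ≤ j) (hm : 2 ≤ m) (hS : 0 < S)
    (hA : 0 < A) (hA' : 0 < A') (hQ : A + D = Q) (hQ' : A' + D' = Q)
    (h : upperTailCheck (j + m) j Q A D A' D' S = true) :
    natCdf (j + m) j A D ≤ natCdf (j + m) (j + 2) A' D' ∧
      100 * natCdf (j + m) (j + 2) A' D' ≤ 73 * Q ^ (j + m) := by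
  simp only [upperTailCheck, forced_eq, Bool.and_eq_true, Nat.ble_eq, Nat.mul_eq, Nat.pow_eq,
    Nat.add_sub_cancel_left] at h
  obtain ⟨h1, h2⟩ := h
  have hB := natCdf_le_floorSum (n := j + m) (k := m - 1) (A := D') (S := S) (by omega) hA'
  have hB' := floorSum_le_natCdf (n := j + m) (k := m - 1) (A := D') (S := S) (by omega) hA'
  have hC := floorSum_le_natCdf (n := j + m) (k := m + 1) (A := D) (S := S) (by omega) hA
  have hr := natCdf_add_reflect (n := j + m) (k := j) (by omega) A D
  have hr' := natCdf_add_reflect (n := j + m) (k := j + 2) (by omega) A' D'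
  rw [(by omega : j + m + 1 - j = m + 1), hQ] at hr
  rw [(by omega : j + m + 1 - (j + 2) = m - 1), hQ'] at hr'
  have h3 : natCdf (j + m) (m - 1) D' A' ≤ natCdf (j + m) (m + 1) D A := by
    refine Nat.le_of_mul_le_mul_left (c := S ^ (m - 1) * S) ?_ (by positivity)
    calc _ = S ^ (m - 1) * (S * natCdf (j + m) (m - 1) D' A') := by ring
      _ ≤ _ := hB
      _ ≤ _ := h1
      _ ≤ _ := Nat.mul_le_mul_left _ hC
      _ = _ := by ring
  have h4 : 27 * Q ^ (j + m) ≤ 100 * natCdf (j + m) (m - 1) D' A' := by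
    refine Nat.le_of_mul_le_mul_left (c := S) ?_ hS
    calc _ = 27 * S * Q ^ (j + m) := by ring
      _ ≤ _ := h2
      _ ≤ _ := Nat.mul_le_mul_left _ hB'
      _ = _ := by ring
  omega

theorem endpointCheck_basic {n j Q A D A' D' : ℕ} (h : endpointCheck n j Q A D A' D' = true) :
    0 < A ∧ 0 < D ∧ 0 < A' ∧ 0 < D' ∧ A + D = Q ∧ A' + D' = Q := by
  simp only [endpointCheck, Bool.and_eq_true, Nat.ble_eq] at h
  omega

theorem hasEndpoints_of_interiorCheck {j m : ℕ} (hj : 1 ≤ j) (hm : 2 ≤ m)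
    (h : interiorCheck (j + m) j = true) : HasEndpoints j m := by
  rw [interiorCheck, Bool.cond_eq_ite] at h
  split at h
  · simp only [upperCheck, forced_eq, Bool.and_eq_true] at h
    obtain ⟨hA, -, hA', -, hQ, hQ'⟩ := endpointCheck_basic h.1
    obtain ⟨h1, h2⟩ := natCdf_le_of_upperTailCheck hj hm (by norm_num) hA hA' hQ hQ' h.2
    exact hasEndpoints_of_endpointCheck hj hm h.1 h1 h2
  · simp only [lowerCheck, forced_eq, Bool.and_eq_true] at h
    obtain ⟨-, hD, -, hD', -, -⟩ := endpointCheck_basic h.1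
    obtain ⟨h1, h2⟩ := natCdf_le_of_lowerTailCheck hm (by norm_num) hD hD' h.2
    exact hasEndpoints_of_endpointCheck hj hm h.1 h1 h2

theorem rowCheck_all {n : ℕ} (hn : n ≤ 200) : rowCheck n = true := by
  have shift : ∀ {s c : ℕ}, allBelow (fun t => rowCheck (t + s)) c = true → s ≤ n → n < s + c →
      rowCheck n = true := by
    intro s c h h1 h2
    simpa [Nat.sub_add_cancel h1] using allBelow_spec h (n - s) (by omega)
  rcases lt_or_ge n 100 with h | h
  · exact allBelow_spec rowCheck_below_100 n h
  rcases lt_or_ge n 135 with h' | h'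
  · exact shift rowCheck_below_135 h h'
  rcases lt_or_ge n 160 with h | h
  · exact shift rowCheck_below_160 h' h
  rcases lt_or_ge n 175 with h' | h'
  · exact shift rowCheck_below_175 h h'
  rcases lt_or_ge n 188 with h | h
  · exact shift rowCheck_below_188 h' h
  · exact shift rowCheck_below_201 h (by omega)

theorem hasEndpoints_of_le {j m : ℕ} (hj : 1 ≤ j) (hm : 2 ≤ m) (hn : j + m ≤ 200) :
    HasEndpoints j m := by
  have h := rowCheck_all hn
  rw [rowCheck, forced_eq] at h
  have h2 := allBelow_spec h (j - 1) (by omega)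
  rw [forced_eq, Nat.sub_add_cancel hj] at h2
  exact hasEndpoints_of_interiorCheck hj hm h2

theorem exists_first_endpoint {n : ℕ} (hn : 2 ≤ n) (hn' : n ≤ 200) :
    ∃ b₁ ∈ Set.Ioo (0 : ℝ) 1, 27 / 100 ≤ binTail n 2 b₁ ∧
      binTail n 2 b₁ ≤ n ^ 2 * (b₁ ^ 2 * (1 - b₁) ^ (n - 1)) := by
  have h := allBelow_spec firstCheck_below_199 (n - 2) (by omega)
  simp only [Nat.sub_add_cancel hn, firstCheck, Bool.and_eq_true, Nat.ble_eq] at h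
  obtain ⟨h1, h2⟩ := h
  obtain ⟨D, hD⟩ : ∃ D, 5 * n = 7 + D := Nat.exists_eq_add_of_le (by omega)
  have hcdf : natCdf n 2 7 D = D ^ n + 7 * n * D ^ (n - 1) := by
    simp only [natCdf, Finset.sum_range_succ, Finset.sum_range_zero, Nat.choose_zero_right,
      Nat.choose_one_right, pow_zero, pow_one, Nat.sub_zero]
    ring
  have hnR : (2 : ℝ) ≤ n := by exact_mod_cast hn
  have hDR : 5 * (n : ℝ) = 7 + D := by exact_mod_cast hD
  rw [hD, Nat.add_sub_cancel_left, ← hcdf] at h1 h2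
  have hQ : (0 : ℝ) < ((7 + D : ℕ) : ℝ) := by positivity
  have h1' : (100 : ℝ) * natCdf n 2 7 D ≤ 73 * ((7 + D : ℕ) : ℝ) ^ n := by exact_mod_cast h1
  have h2' : ((7 + D : ℕ) : ℝ) * ((7 + D : ℕ) : ℝ) ^ n
      ≤ ((7 + D : ℕ) : ℝ) * natCdf n 2 7 D + 49 * n ^ 2 * D ^ (n - 1) := by exact_mod_cast h2
  refine ⟨(7 : ℕ) / (7 + D : ℕ), ⟨by positivity, ?_⟩, ?_, ?_⟩
  · rw [div_lt_one hQ]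
    push_cast
    linarith
  · rw [binTail_div (by omega) (by omega), le_sub_comm, div_le_iff₀ (by positivity)]
    linarith
  · rw [binTail_div (by omega) (by omega), pow_mul_pow_div 7 D 2 (n - 1) (n + 1) (by omega)
      (by omega), ← mul_div_assoc, le_div_iff₀ (by positivity), pow_succ]
    push_cast at h2' ⊢
    have : (0 : ℝ) < 7 + D := by positivity
    field_simp
    linarith

theorem last_weight_lt {k : ℕ} (hk : 1 ≤ k) (hk' : k + 1 ≤ 200) {α : ℝ} (hα : α < 27 / 100) :
    4 * (((k : ℝ) + 1) ^ 2 * (k : ℝ) ^ k) < (1 - α) * (k + 2) ^ (k + 2) := by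
  have h := allBelow_spec lastCheck_below_200 (k - 1) (by omega)
  simp only [Nat.sub_add_cancel hk, lastCheck, Nat.ble_eq] at h
  have h' : (400 : ℝ) * (((k : ℝ) + 1) ^ 2 * (k : ℝ) ^ k) ≤ 73 * ((k : ℝ) + 2) ^ (k + 2) := by
    exact_mod_cast h
  have hP : (0 : ℝ) < ((k : ℝ) + 2) ^ (k + 2) := by positivity
  have : 73 / 100 * ((k : ℝ) + 2) ^ (k + 2) < (1 - α) * (k + 2) ^ (k + 2) :=
    mul_lt_mul_of_pos_right (by linarith) hP
  linarith

theorem exists_quantiles (n : ℕ) {α : ℝ} (hα : α ∈ Set.Ioo (0 : ℝ) 1) :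
    ∃ Q : ℕ → ℝ, Q 0 = 0 ∧ Q (n + 1) = 1 ∧
      ∀ k, 1 ≤ k → k ≤ n → Q k ∈ Set.Ioo (0 : ℝ) 1 ∧ binTail n k (Q k) = α := by
  have hex : ∀ k, ∃ c, 1 ≤ k → k ≤ n → c ∈ Set.Ioo (0 : ℝ) 1 ∧ binTail n k c = α := by
    intro k
    by_cases hk : 1 ≤ k ∧ k ≤ n
    · obtain ⟨q, -, -, hv, hd⟩ := exists_quantile hk.1 hk.2
      exact ⟨q α, fun _ _ => ⟨(hd α hα).1, (hv α (Set.Ioo_subset_Icc_self hα)).2⟩⟩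
    · exact ⟨0, fun h1 h2 => absurd ⟨h1, h2⟩ hk⟩
  choose q hq using hex
  refine ⟨fun k => if k = 0 then 0 else if k = n + 1 then 1 else q k, by simp, by simp, ?_⟩
  intro k h1 h2
  simp only [if_neg (by omega : k ≠ 0), if_neg (by omega : k ≠ n + 1)]
  exact hq k h1 h2

theorem integral_between_quantiles_pos {n : ℕ} (hn : n ≤ 200) {α : ℝ} (hα : 0 < α)
    (hα' : α < 27 / 100) {Q : ℕ → ℝ} (hQ0 : Q 0 = 0) (hQn : Q (n + 1) = 1)
    (hQ : ∀ k, 1 ≤ k → k ≤ n → Q k ∈ Set.Ioo (0 : ℝ) 1 ∧ binTail n k (Q k) = α)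
    (k : ℕ) (hk : k + 1 ≤ n) : 0 < ∫ p in (Q k)..(Q (k + 2)), (binTail n (k + 1) p - α) := by
  have hmem : ∀ k, 1 ≤ k → k ≤ n → Q k ∈ Set.Icc (0 : ℝ) 1 := fun k h1 h2 =>
    Set.Ioo_subset_Icc_self (hQ k h1 h2).1
  rcases Nat.eq_zero_or_pos k with rfl | hk0
  · rw [hQ0]
    rcases hk.eq_or_lt with rfl | hk1
    · rw [hQn]
      exact integral_single_pos (by linarith)
    · obtain ⟨b₁, hb₁, hlevel, hweight⟩ := exists_first_endpoint hk1 hn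
      exact integral_first_pos hk1 hb₁ hweight hα (by linarith) (hmem 2 (by norm_num) hk1)
        (hQ 2 (by norm_num) hk1).2
  · rcases hk.eq_or_lt with rfl | hk1
    · rw [hQn]
      exact integral_last_pos hk0 (last_weight_lt hk0 hn hα') (hmem k hk0 (by omega))
        (hQ k hk0 (by omega)).2
    · obtain ⟨m, rfl⟩ := Nat.exists_eq_add_of_le (by omega : k ≤ n)
      obtain ⟨a₁, b₁, ha₁, hb₁, htail, hweight, hmode, hline, hlevel⟩ :=
        hasEndpoints_of_le (m := m) hk0 (by omega) hn
      exact integral_interior_pos hk0 (by omega) ha₁ hb₁ htail hweight hmode hline hα (by linarith)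
        (hmem k hk0 (by omega)) (hmem (k + 2) (by omega) (by omega))
        (hQ k hk0 (by omega)).2 (hQ (k + 2) (by omega) (by omega)).2

theorem stmt_15 (n : ℕ) (hn1 : 1 ≤ n) (hn2 : n ≤ 200)
    (α : ℝ) (hα1 : (0.0001 : ℝ) < α) (hα2 : α < 0.27)
    (j : ℕ) (hj : j ≤ n - 1)
    (l : ℕ → ℝ) (hl0 : l 0 = 0)
    (hmono : ∀ i, i < j → l i < l (i + 1)) (hlj : l j < 1)
    (heq : ∀ i, i < j →
      (∫ p in (l i)..(l (i + 1)), ∑ x ∈ Finset.range (i + 1), B n x p)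
        = (1 - α) * (l (i + 1) - l i)) :
    ∃! b : ℝ, l j < b ∧ b < 1 ∧
      (∫ p in (l j)..b, ∑ x ∈ Finset.range (j + 1), B n x p)
        = (1 - α) * (b - l j) := by
  obtain ⟨Q, hQ0, hQn, hQ⟩ := exists_quantiles n (α := α) ⟨by linarith, by linarith⟩
  exact existsUnique_next_endpoint hQ0 hQn hQ (integral_between_quantiles_pos hn2 (by linarith)
    (by linarith) hQ0 hQn hQ) (by omega) hl0 hmono hlj heq
end
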